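/- Transport of A∞-algebra structures: Let (A, m) be an A∞-algebra, let B be a graded vector space, and let f_k : A[1]^{⊗k} → B (k ≥ 1) be a family of multilinear maps such that f_1 is a vector space isomorphism. Then there exists an A∞-algebra structure on B such that f = {f_k} defines an A∞-quasi-isomorphism from A to B. -/

import Mathlib

/-!
Core framework for (strict) A∞-algebras over a field `k` of characteristic zero,
their bimodules, duals, cyclic inner products, homomorphisms, and the various
(strong) homotopy inner product notions, following Cho, "Strong homotopy inner
product of an A∞-algebra".

We model a ℤ-graded vector space as a family of `k`-modules indexed by the
*shifted* degree (i.e. the degree in `A[1]`).  Homogeneous elements are modelled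
by the sigma type `El`.  All operations are given on homogeneous elements, with
multilinearity recorded as explicit axioms; identities between homogeneous
elements of a fixed degree are expressed using the projection `toComp` onto a
graded component (which is the identity when degrees match and `0` otherwise).
Koszul signs are written via `sg : ℤ → k`, `sg n = (-1)^n`.
-/

noncomputable section

open Finset

/-- `(-1)^n` as an element of `k`. -/
def sg (k : Type) [Field k] (n : ℤ) : k := if Even n then 1 else -1

/-- A ℤ-graded `k`-vector space (components indexed by shifted degree). -/
structure GradedSpace (k : Type) [Field k] where
  comp : ℤ → Type
  acg : ∀ i, AddCommGroup (comp i)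
  mod : ∀ i, Module k (comp i)

attribute [instance] GradedSpace.acg GradedSpace.mod

namespace GradedSpace

variable {k : Type} [Field k]

/-- Homogeneous elements (an element together with its shifted degree). -/
def El (V : GradedSpace k) : Type := Σ i : ℤ, V.comp i

/-- Projection of a homogeneous element onto the degree-`D` component
(the identity if the degrees match, `0` otherwise). -/
def toComp (V : GradedSpace k) (D : ℤ) (x : V.El) : V.comp D :=
  if h : x.1 = D then h ▸ x.2 else 0

/-- The zero homogeneous element (placed in degree `0`). -/
def zeroEl (V : GradedSpace k) : V.El := ⟨0, 0⟩

/-- Difference of homogeneous elements (computed in the degree of the first). -/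
def subEl (V : GradedSpace k) (x y : V.El) : V.El := ⟨x.1, x.2 - V.toComp x.1 y⟩

end GradedSpace

/-- Insert the value `v` at position `i` into the sequence `x`, where `v`
replaces the `len` consecutive entries `x i, …, x (i+len-1)`. -/
def insertAt {α : Type} (x : ℕ → α) (i len : ℕ) (v : α) : ℕ → α :=
  fun j => if j < i then x j else if j = i then v else x (j + len - 1)

/-- The shifted sequence `x (i+·)`. -/
def shiftSeq {α : Type} (x : ℕ → α) (i : ℕ) : ℕ → α := fun j => x (i + j)

/-- Concatenation `u_0, …, u_{nu-1}, v, w_0, w_1, …`. -/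
def cat3 {α : Type} (u : ℕ → α) (nu : ℕ) (v : α) (w : ℕ → α) : ℕ → α :=
  fun j => if j < nu then u j else if j = nu then v else w (j - nu - 1)

/-- Sum of the (shifted) degrees of the first `n` entries of `x`. -/
def dsum {k : Type} [Field k] {V : GradedSpace k} (x : ℕ → V.El) (n : ℕ) : ℤ :=
  ∑ t ∈ Finset.range n, (x t).1

/-- `x` is a cycle for the (degree `+1`) differential `dop`. -/
def IsCycleAt {k : Type} [Field k] (V : GradedSpace k) (dop : V.El → V.El) (x : V.El) : Prop :=
  dop x = ⟨x.1 + 1, 0⟩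

/-- `x` is a boundary for the differential `dop`. -/
def IsBdryAt {k : Type} [Field k] (V : GradedSpace k) (dop : V.El → V.El) (x : V.El) : Prop :=
  ∃ y, dop y = x

/-- The axioms for a strict A∞-algebra structure `m` on `V`:
compatibility with sequences (only the first `n` inputs matter), strictness
(`m₀ = 0`), the degree (+1) condition, multilinearity, and the A∞-relations
`Σ ± m(x₁,…,m(xᵢ,…),…,x_k) = 0` with Koszul signs. -/
def AlgFamProps (k : Type) [Field k] (V : GradedSpace k)
    (m : ℕ → (ℕ → V.El) → V.El) : Prop :=
  (∀ n (x y : ℕ → V.El), (∀ i < n, x i = y i) → m n x = m n y) ∧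
  (∀ x, m 0 x = ⟨1, 0⟩) ∧
  (∀ n x, (m n x).1 = 1 + dsum x n) ∧
  (∀ n (x : ℕ → V.El) i, i < n → ∀ (a b : V.comp (x i).1) (D : ℤ),
    V.toComp D (m n (Function.update x i ⟨(x i).1, a + b⟩)) =
      V.toComp D (m n (Function.update x i ⟨(x i).1, a⟩)) +
        V.toComp D (m n (Function.update x i ⟨(x i).1, b⟩))) ∧
  (∀ n (x : ℕ → V.El) i, i < n → ∀ (c : k) (a : V.comp (x i).1) (D : ℤ),
    V.toComp D (m n (Function.update x i ⟨(x i).1, c • a⟩)) =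
      c • V.toComp D (m n (Function.update x i ⟨(x i).1, a⟩))) ∧
  (∀ n (x : ℕ → V.El), 1 ≤ n →
    ∑ i ∈ Finset.range n, ∑ len ∈ Finset.Icc 1 (n - i),
      sg k (dsum x i) •
        V.toComp (2 + dsum x n)
          (m (n - len + 1) (insertAt x i len (m len (shiftSeq x i)))) = 0)

/-- A strict A∞-algebra over `k`. -/
structure AInftyAlg (k : Type) [Field k] where
  V : GradedSpace k
  m : ℕ → (ℕ → V.El) → V.El
  props : AlgFamProps k V m

/-- The differential `m₁` of an A∞-algebra. -/
def AInftyAlg.d {k : Type} [Field k] (A : AInftyAlg k) : A.V.El → A.V.El :=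
  fun x => A.m 1 (fun _ => x)

/-- A cyclic symmetric inner product on an A∞-algebra: a nondegenerate,
skew-symmetric (in shifted degrees) bilinear pairing satisfying
`⟨m_k(x₁,…,x_k),x_{k+1}⟩ = ±⟨m_k(x₂,…,x_{k+1}),x₁⟩` with Koszul sign. -/
structure CyclicIP (k : Type) [Field k] (A : AInftyAlg k) where
  ip : A.V.El → A.V.El → k
  add_left : ∀ (i : ℤ) (a b : A.V.comp i) (y), ip ⟨i, a + b⟩ y = ip ⟨i, a⟩ y + ip ⟨i, b⟩ y
  smul_left : ∀ (i : ℤ) (c : k) (a : A.V.comp i) (y), ip ⟨i, c • a⟩ y = c * ip ⟨i, a⟩ y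
  add_right : ∀ (x) (i : ℤ) (a b : A.V.comp i), ip x ⟨i, a + b⟩ = ip x ⟨i, a⟩ + ip x ⟨i, b⟩
  smul_right : ∀ (x) (i : ℤ) (c : k) (a : A.V.comp i), ip x ⟨i, c • a⟩ = c * ip x ⟨i, a⟩
  skew : ∀ x y, ip x y + sg k (x.1 * y.1) * ip y x = 0
  nondeg : ∀ x : A.V.El, x.2 ≠ 0 → ∃ y, ip x y ≠ 0
  cyclic : ∀ n (x : ℕ → A.V.El), 1 ≤ n →
    ip (A.m n x) (x n) =
      sg k ((x 0).1 * dsum (shiftSeq x 1) n) * ip (A.m n (shiftSeq x 1)) (x 0)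

/-- The axioms for a family `f = {f_n}` to be an A∞-homomorphism from `A` to the
A∞-structure `mW` on `W` (degree-zero, multilinear, satisfying
`f̂ ∘ m̂ᴬ = m̂ᵂ ∘ f̂`; the right-hand side is a sum over compositions of `n`). -/
def HomFamProps (k : Type) [Field k] (A : AInftyAlg k) (W : GradedSpace k)
    (mW : ℕ → (ℕ → W.El) → W.El) (f : ℕ → (ℕ → A.V.El) → W.El) : Prop :=
  (∀ n (x y : ℕ → A.V.El), (∀ i < n, x i = y i) → f n x = f n y) ∧
  (∀ n x, 1 ≤ n → (f n x).1 = dsum x n) ∧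
  (∀ n (x : ℕ → A.V.El) i, i < n → ∀ (a b : A.V.comp (x i).1) (D : ℤ),
    W.toComp D (f n (Function.update x i ⟨(x i).1, a + b⟩)) =
      W.toComp D (f n (Function.update x i ⟨(x i).1, a⟩)) +
        W.toComp D (f n (Function.update x i ⟨(x i).1, b⟩))) ∧
  (∀ n (x : ℕ → A.V.El) i, i < n → ∀ (c : k) (a : A.V.comp (x i).1) (D : ℤ),
    W.toComp D (f n (Function.update x i ⟨(x i).1, c • a⟩)) =
      c • W.toComp D (f n (Function.update x i ⟨(x i).1, a⟩))) ∧
  (∀ n (x : ℕ → A.V.El), 1 ≤ n →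
    ∑ i ∈ Finset.range n, ∑ len ∈ Finset.Icc 1 (n - i),
      sg k (dsum x i) •
        W.toComp (1 + dsum x n)
          (f (n - len + 1) (insertAt x i len (A.m len (shiftSeq x i))))
    = ∑ c : Composition n,
        W.toComp (1 + dsum x n)
          (mW c.length (fun j =>
            if h : j < c.length then f (c.blocksFun ⟨j, h⟩) (shiftSeq x (c.sizeUpTo j))
            else W.zeroEl)))

/-- An A∞-homomorphism between A∞-algebras. -/
structure AInftyHom (k : Type) [Field k] (A B : AInftyAlg k) where
  f : ℕ → (ℕ → A.V.El) → B.V.El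
  props : HomFamProps k A B.V B.m f

/-- An A∞-quasi-isomorphism: an A∞-homomorphism whose first Taylor coefficient
induces an isomorphism on `m₁`-homology. -/
structure AInftyQuasiIso (k : Type) [Field k] (A B : AInftyAlg k) extends AInftyHom k A B where
  surj : ∀ y : B.V.El, IsCycleAt B.V B.d y →
    ∃ x : A.V.El, x.1 = y.1 ∧ IsCycleAt A.V A.d x ∧
      IsBdryAt B.V B.d (B.V.subEl (f 1 (fun _ => x)) y)
  inj : ∀ x : A.V.El, IsCycleAt A.V A.d x →
    IsBdryAt B.V B.d (f 1 (fun _ => x)) → IsBdryAt A.V A.d x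

/-! ### A∞-bimodules -/

/-- The shape of an A∞-bimodule structure (a family `b_{k,l}`) on `M` over `A`. -/
def BFam (k : Type) [Field k] (A : AInftyAlg k) (M : GradedSpace k) : Type :=
  ℕ → ℕ → (ℕ → A.V.El) → M.El → (ℕ → A.V.El) → M.El

/-- `A` as an A∞-bimodule over itself: `b_{k,l} = m_{k+l+1}`. -/
def selfB (k : Type) [Field k] (A : AInftyAlg k) : BFam k A A.V :=
  fun kk l x v y => A.m (kk + l + 1) (cat3 x kk v y)

/-- Only the first `k` resp. `l` entries of the algebra inputs matter. -/
def BFamExt (k : Type) [Field k] (A : AInftyAlg k) (M : GradedSpace k) (b : BFam k A M) : Prop :=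
  ∀ kk l x x' v y y', (∀ i < kk, x i = x' i) → (∀ j < l, y j = y' j) →
    b kk l x v y = b kk l x' v y'

/-- The degree (+1) condition for a bimodule structure. -/
def BFamDeg (k : Type) [Field k] (A : AInftyAlg k) (M : GradedSpace k) (b : BFam k A M) : Prop :=
  ∀ kk l x v y, (b kk l x v y).1 = 1 + dsum x kk + v.1 + dsum y l

/-- Multilinearity of a bimodule structure in all slots. -/
def BFamLin (k : Type) [Field k] (A : AInftyAlg k) (M : GradedSpace k) (b : BFam k A M) : Prop :=
  (∀ kk l (x : ℕ → A.V.El) i, i < kk → ∀ (a a' : A.V.comp (x i).1) v y (D : ℤ),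
    M.toComp D (b kk l (Function.update x i ⟨(x i).1, a + a'⟩) v y) =
      M.toComp D (b kk l (Function.update x i ⟨(x i).1, a⟩) v y) +
        M.toComp D (b kk l (Function.update x i ⟨(x i).1, a'⟩) v y)) ∧
  (∀ kk l (x : ℕ → A.V.El) i, i < kk → ∀ (c : k) (a : A.V.comp (x i).1) v y (D : ℤ),
    M.toComp D (b kk l (Function.update x i ⟨(x i).1, c • a⟩) v y) =
      c • M.toComp D (b kk l (Function.update x i ⟨(x i).1, a⟩) v y)) ∧
  (∀ kk l x (y : ℕ → A.V.El) j, j < l → ∀ (a a' : A.V.comp (y j).1) v (D : ℤ),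
    M.toComp D (b kk l x v (Function.update y j ⟨(y j).1, a + a'⟩)) =
      M.toComp D (b kk l x v (Function.update y j ⟨(y j).1, a⟩)) +
        M.toComp D (b kk l x v (Function.update y j ⟨(y j).1, a'⟩))) ∧
  (∀ kk l x (y : ℕ → A.V.El) j, j < l → ∀ (c : k) (a : A.V.comp (y j).1) v (D : ℤ),
    M.toComp D (b kk l x v (Function.update y j ⟨(y j).1, c • a⟩)) =
      c • M.toComp D (b kk l x v (Function.update y j ⟨(y j).1, a⟩))) ∧
  (∀ kk l x (dv : ℤ) (a a' : M.comp dv) y (D : ℤ),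
    M.toComp D (b kk l x ⟨dv, a + a'⟩ y) =
      M.toComp D (b kk l x ⟨dv, a⟩ y) + M.toComp D (b kk l x ⟨dv, a'⟩ y)) ∧
  (∀ kk l x (dv : ℤ) (c : k) (a : M.comp dv) y (D : ℤ),
    M.toComp D (b kk l x ⟨dv, c • a⟩ y) = c • M.toComp D (b kk l x ⟨dv, a⟩ y))

/-- The A∞-bimodule relation `b̂ ∘ b̂ = 0`, in unrolled (component) form. -/
def BimodRel (k : Type) [Field k] (A : AInftyAlg k) (M : GradedSpace k) (b : BFam k A M) : Prop :=
  ∀ kk l (x : ℕ → A.V.El) (v : M.El) (y : ℕ → A.V.El),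
    (∑ i ∈ Finset.range kk, ∑ len ∈ Finset.Icc 1 (kk - i),
      sg k (dsum x i) •
        M.toComp (2 + dsum x kk + v.1 + dsum y l)
          (b (kk - len + 1) l (insertAt x i len (A.m len (shiftSeq x i))) v y))
    + (∑ j ∈ Finset.range l, ∑ len ∈ Finset.Icc 1 (l - j),
      sg k (dsum x kk + v.1 + dsum y j) •
        M.toComp (2 + dsum x kk + v.1 + dsum y l)
          (b kk (l - len + 1) x v (insertAt y j len (A.m len (shiftSeq y j)))))
    + (∑ i ∈ Finset.range (kk + 1), ∑ j ∈ Finset.range (l + 1),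
      sg k (dsum x i) •
        M.toComp (2 + dsum x kk + v.1 + dsum y l)
          (b i (l - j) x (b (kk - i) j (shiftSeq x i) v y) (shiftSeq y j)))
    = 0

/-- An A∞-bimodule over `A`. -/
structure AInftyBimod (k : Type) [Field k] (A : AInftyAlg k) where
  M : GradedSpace k
  b : BFam k A M
  ext : BFamExt k A M b
  deg : BFamDeg k A M b
  lin : BFamLin k A M b
  rel : BimodRel k A M b

/-- The differential `b_{0,0}` of an A∞-bimodule. -/
def AInftyBimod.d {k : Type} [Field k] {A : AInftyAlg k} (Mb : AInftyBimod k A) :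
    Mb.M.El → Mb.M.El :=
  fun v => Mb.b 0 0 (fun _ => A.V.zeroEl) v (fun _ => A.V.zeroEl)

/-- The shape of a map of A∞-bimodules from `M` to `N` over `A`. -/
def MFam (k : Type) [Field k] (A : AInftyAlg k) (M N : GradedSpace k) : Type :=
  ℕ → ℕ → (ℕ → A.V.El) → M.El → (ℕ → A.V.El) → N.El

/-- Only the first `k` resp. `l` entries of the algebra inputs matter. -/
def MFamExt (k : Type) [Field k] (A : AInftyAlg k) (M N : GradedSpace k)
    (g : MFam k A M N) : Prop :=
  ∀ kk l x x' v y y', (∀ i < kk, x i = x' i) → (∀ j < l, y j = y' j) →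
    g kk l x v y = g kk l x' v y'

/-- Degree-zero condition for a bimodule map. -/
def MFamDeg (k : Type) [Field k] (A : AInftyAlg k) (M N : GradedSpace k)
    (g : MFam k A M N) : Prop :=
  ∀ kk l x v y, (g kk l x v y).1 = dsum x kk + v.1 + dsum y l

/-- Multilinearity of a bimodule map in all slots. -/
def MFamLin (k : Type) [Field k] (A : AInftyAlg k) (M N : GradedSpace k)
    (g : MFam k A M N) : Prop :=
  (∀ kk l (x : ℕ → A.V.El) i, i < kk → ∀ (a a' : A.V.comp (x i).1) v y (D : ℤ),
    N.toComp D (g kk l (Function.update x i ⟨(x i).1, a + a'⟩) v y) =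
      N.toComp D (g kk l (Function.update x i ⟨(x i).1, a⟩) v y) +
        N.toComp D (g kk l (Function.update x i ⟨(x i).1, a'⟩) v y)) ∧
  (∀ kk l (x : ℕ → A.V.El) i, i < kk → ∀ (c : k) (a : A.V.comp (x i).1) v y (D : ℤ),
    N.toComp D (g kk l (Function.update x i ⟨(x i).1, c • a⟩) v y) =
      c • N.toComp D (g kk l (Function.update x i ⟨(x i).1, a⟩) v y)) ∧
  (∀ kk l x (y : ℕ → A.V.El) j, j < l → ∀ (a a' : A.V.comp (y j).1) v (D : ℤ),
    N.toComp D (g kk l x v (Function.update y j ⟨(y j).1, a + a'⟩)) =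
      N.toComp D (g kk l x v (Function.update y j ⟨(y j).1, a⟩)) +
        N.toComp D (g kk l x v (Function.update y j ⟨(y j).1, a'⟩))) ∧
  (∀ kk l x (y : ℕ → A.V.El) j, j < l → ∀ (c : k) (a : A.V.comp (y j).1) v (D : ℤ),
    N.toComp D (g kk l x v (Function.update y j ⟨(y j).1, c • a⟩)) =
      c • N.toComp D (g kk l x v (Function.update y j ⟨(y j).1, a⟩))) ∧
  (∀ kk l x (dv : ℤ) (a a' : M.comp dv) y (D : ℤ),
    N.toComp D (g kk l x ⟨dv, a + a'⟩ y) =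
      N.toComp D (g kk l x ⟨dv, a⟩ y) + N.toComp D (g kk l x ⟨dv, a'⟩ y)) ∧
  (∀ kk l x (dv : ℤ) (c : k) (a : M.comp dv) y (D : ℤ),
    N.toComp D (g kk l x ⟨dv, c • a⟩ y) = c • N.toComp D (g kk l x ⟨dv, a⟩ y))

/-- The A∞-bimodule map relation `g ∘ b̂ᴹ = b̂ᴺ ∘ ĝ`, in unrolled form. -/
def BMapRel (k : Type) [Field k] (A : AInftyAlg k) (M N : GradedSpace k)
    (bM : BFam k A M) (bN : BFam k A N) (g : MFam k A M N) : Prop :=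
  ∀ kk l (x : ℕ → A.V.El) (v : M.El) (y : ℕ → A.V.El),
    (∑ i ∈ Finset.range kk, ∑ len ∈ Finset.Icc 1 (kk - i),
      sg k (dsum x i) •
        N.toComp (1 + dsum x kk + v.1 + dsum y l)
          (g (kk - len + 1) l (insertAt x i len (A.m len (shiftSeq x i))) v y))
    + (∑ j ∈ Finset.range l, ∑ len ∈ Finset.Icc 1 (l - j),
      sg k (dsum x kk + v.1 + dsum y j) •
        N.toComp (1 + dsum x kk + v.1 + dsum y l)
          (g kk (l - len + 1) x v (insertAt y j len (A.m len (shiftSeq y j)))))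
    + (∑ i ∈ Finset.range (kk + 1), ∑ j ∈ Finset.range (l + 1),
      sg k (dsum x i) •
        N.toComp (1 + dsum x kk + v.1 + dsum y l)
          (g i (l - j) x (bM (kk - i) j (shiftSeq x i) v y) (shiftSeq y j)))
    = ∑ i ∈ Finset.range (kk + 1), ∑ j ∈ Finset.range (l + 1),
        sg k (dsum x i) •
          N.toComp (1 + dsum x kk + v.1 + dsum y l)
            (bN i (l - j) x (g (kk - i) j (shiftSeq x i) v y) (shiftSeq y j))

/-- A map of A∞-bimodules over `A`. -/
structure BimodMap (k : Type) [Field k] (A : AInftyAlg k) (Mb Nb : AInftyBimod k A) where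
  g : MFam k A Mb.M Nb.M
  ext : MFamExt k A Mb.M Nb.M g
  deg : MFamDeg k A Mb.M Nb.M g
  lin : MFamLin k A Mb.M Nb.M g
  rel : BMapRel k A Mb.M Nb.M Mb.b Nb.b g

/-- A quasi-isomorphism of A∞-bimodules (`g_{0,0}` induces an isomorphism on
`b_{0,0}`-homology). -/
structure BimodQuasiIso (k : Type) [Field k] (A : AInftyAlg k) (Mb Nb : AInftyBimod k A)
    extends BimodMap k A Mb Nb where
  surj : ∀ w : Nb.M.El, IsCycleAt Nb.M Nb.d w →
    ∃ v : Mb.M.El, v.1 = w.1 ∧ IsCycleAt Mb.M Mb.d v ∧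
      IsBdryAt Nb.M Nb.d
        (Nb.M.subEl (g 0 0 (fun _ => A.V.zeroEl) v (fun _ => A.V.zeroEl)) w)
  inj : ∀ v : Mb.M.El, IsCycleAt Mb.M Mb.d v →
    IsBdryAt Nb.M Nb.d (g 0 0 (fun _ => A.V.zeroEl) v (fun _ => A.V.zeroEl)) →
    IsBdryAt Mb.M Mb.d v

/-- A cyclic symmetric inner product on an A∞-bimodule `Mb` over `A`
(Definition of cyclic bimodule pairings):
`⟨b_{k,l}(a⃗,v,c⃗), w⟩ = ±⟨v, b_{l,k}(c⃗,w,a⃗)⟩` with Koszul sign. -/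
structure BimodCyclicIP (k : Type) [Field k] {A : AInftyAlg k} (Mb : AInftyBimod k A) where
  ip : Mb.M.El → Mb.M.El → k
  add_left : ∀ (i : ℤ) (a b : Mb.M.comp i) (y), ip ⟨i, a + b⟩ y = ip ⟨i, a⟩ y + ip ⟨i, b⟩ y
  smul_left : ∀ (i : ℤ) (c : k) (a : Mb.M.comp i) (y), ip ⟨i, c • a⟩ y = c * ip ⟨i, a⟩ y
  add_right : ∀ (x) (i : ℤ) (a b : Mb.M.comp i), ip x ⟨i, a + b⟩ = ip x ⟨i, a⟩ + ip x ⟨i, b⟩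
  smul_right : ∀ (x) (i : ℤ) (c : k) (a : Mb.M.comp i), ip x ⟨i, c • a⟩ = c * ip x ⟨i, a⟩
  skew : ∀ x y, ip x y + sg k (x.1 * y.1) * ip y x = 0
  nondeg : ∀ x : Mb.M.El, x.2 ≠ 0 → ∃ y, ip x y ≠ 0
  cyc : ∀ kk l (x : ℕ → A.V.El) (v : Mb.M.El) (y : ℕ → A.V.El) (w : Mb.M.El),
    ip (Mb.b kk l x v y) w =
      sg k (v.1 + dsum x kk * (v.1 + dsum y l + w.1)) * ip v (Mb.b l kk y w x)

/-! ### Maps into the dual bimodule, in scalar (evaluated) form -/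

/-- The shape of a map of A∞-bimodules from `M` into its dual `M*` over `A`,
recorded in evaluated form: `φ k l a⃗ v b⃗ w = φ_{k,l}(a⃗, v, b⃗)(w)`. -/
def DFam (k : Type) [Field k] (A : AInftyAlg k) (M : GradedSpace k) : Type :=
  ℕ → ℕ → (ℕ → A.V.El) → M.El → (ℕ → A.V.El) → M.El → k

/-- Extension and multilinearity axioms for a map into the dual bimodule. -/
def DFamGood (k : Type) [Field k] (A : AInftyAlg k) (M : GradedSpace k)
    (φ : DFam k A M) : Prop :=
  (∀ kk l x x' v y y' w, (∀ i < kk, x i = x' i) → (∀ j < l, y j = y' j) →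
    φ kk l x v y w = φ kk l x' v y' w) ∧
  (∀ kk l (x : ℕ → A.V.El) i, i < kk → ∀ (a a' : A.V.comp (x i).1) v y w,
    φ kk l (Function.update x i ⟨(x i).1, a + a'⟩) v y w =
      φ kk l (Function.update x i ⟨(x i).1, a⟩) v y w +
        φ kk l (Function.update x i ⟨(x i).1, a'⟩) v y w) ∧
  (∀ kk l (x : ℕ → A.V.El) i, i < kk → ∀ (c : k) (a : A.V.comp (x i).1) v y w,
    φ kk l (Function.update x i ⟨(x i).1, c • a⟩) v y w =
      c * φ kk l (Function.update x i ⟨(x i).1, a⟩) v y w) ∧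
  (∀ kk l x (y : ℕ → A.V.El) j, j < l → ∀ (a a' : A.V.comp (y j).1) v w,
    φ kk l x v (Function.update y j ⟨(y j).1, a + a'⟩) w =
      φ kk l x v (Function.update y j ⟨(y j).1, a⟩) w +
        φ kk l x v (Function.update y j ⟨(y j).1, a'⟩) w) ∧
  (∀ kk l x (y : ℕ → A.V.El) j, j < l → ∀ (c : k) (a : A.V.comp (y j).1) v w,
    φ kk l x v (Function.update y j ⟨(y j).1, c • a⟩) w =
      c * φ kk l x v (Function.update y j ⟨(y j).1, a⟩) w) ∧
  (∀ kk l x (dv : ℤ) (a a' : M.comp dv) y w,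
    φ kk l x ⟨dv, a + a'⟩ y w = φ kk l x ⟨dv, a⟩ y w + φ kk l x ⟨dv, a'⟩ y w) ∧
  (∀ kk l x (dv : ℤ) (c : k) (a : M.comp dv) y w,
    φ kk l x ⟨dv, c • a⟩ y w = c * φ kk l x ⟨dv, a⟩ y w) ∧
  (∀ kk l x v y (dw : ℤ) (a a' : M.comp dw),
    φ kk l x v y ⟨dw, a + a'⟩ = φ kk l x v y ⟨dw, a⟩ + φ kk l x v y ⟨dw, a'⟩) ∧
  (∀ kk l x v y (dw : ℤ) (c : k) (a : M.comp dw),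
    φ kk l x v y ⟨dw, c • a⟩ = c * φ kk l x v y ⟨dw, a⟩)

/-- The A∞-bimodule map relation for a map `φ : M → M*` into the dual bimodule,
written in evaluated (scalar) form: `φ ∘ b̂ᴹ = b̂^{M*} ∘ φ̂`, where the dual
bimodule structure is
`b*_{k,l}(x⃗,v*,y⃗)(w) = (-1)^{1+|v*|'+(Σ|x|')(|v*|'+Σ|y|'+|w|')} v*(b_{l,k}(y⃗,w,x⃗))`. -/
def DualMapRel (k : Type) [Field k] (A : AInftyAlg k) (M : GradedSpace k)
    (bM : BFam k A M) (φ : DFam k A M) : Prop :=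
  ∀ kk l (x : ℕ → A.V.El) (v : M.El) (y : ℕ → A.V.El) (w : M.El),
    (∑ i ∈ Finset.range kk, ∑ len ∈ Finset.Icc 1 (kk - i),
      sg k (dsum x i) *
        φ (kk - len + 1) l (insertAt x i len (A.m len (shiftSeq x i))) v y w)
    + (∑ j ∈ Finset.range l, ∑ len ∈ Finset.Icc 1 (l - j),
      sg k (dsum x kk + v.1 + dsum y j) *
        φ kk (l - len + 1) x v (insertAt y j len (A.m len (shiftSeq y j))) w)
    + (∑ i ∈ Finset.range (kk + 1), ∑ j ∈ Finset.range (l + 1),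
      sg k (dsum x i) *
        φ i (l - j) x (bM (kk - i) j (shiftSeq x i) v y) (shiftSeq y j) w)
    = ∑ i ∈ Finset.range (kk + 1), ∑ j ∈ Finset.range (l + 1),
        sg k (dsum x i) *
          sg k (1 + (dsum (shiftSeq x i) (kk - i) + v.1 + dsum y j) +
            dsum x i * ((dsum (shiftSeq x i) (kk - i) + v.1 + dsum y j) +
              dsum (shiftSeq y j) (l - j) + w.1)) *
          φ (kk - i) j (shiftSeq x i) v y (bM (l - j) i (shiftSeq y j) w x)

/-- Skew-symmetry of a map into the dual bimodule:
`φ_{k,l}(a⃗,v,b⃗)(w) = -(-1)^{(Σ|aᵢ|'+|v|')(Σ|bⱼ|'+|w|')} φ_{l,k}(b⃗,w,a⃗)(v)`. -/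
def DSkew (k : Type) [Field k] (A : AInftyAlg k) (M : GradedSpace k) (φ : DFam k A M) : Prop :=
  ∀ kk l (x : ℕ → A.V.El) (v : M.El) (y : ℕ → A.V.El) (w : M.El),
    φ kk l x v y w =
      - sg k ((dsum x kk + v.1) * (dsum y l + w.1)) * φ l kk y w x v

/-- Evaluation of `φ : A → A*` on a family `z` of `n` elements in cyclic order:
the module input is `z p`, the evaluation input is `z q`, and the remaining
elements are inserted in cyclic order starting after `z q`. -/
def cycEval (k : Type) [Field k] (A : AInftyAlg k) (φ : DFam k A A.V)
    (n : ℕ) (z : ℕ → A.V.El) (p q : ℕ) : k :=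
  φ ((p + n - q - 1) % n) ((q + n - p - 1) % n)
    (fun t => z ((q + 1 + t) % n)) (z p) (fun t => z ((p + 1 + t) % n)) (z q)

/-- The closedness condition for a map `φ : A → A*`: for every family
`(a_1, …, a_n)` and indices `i < j < K` of the family, the three-term cyclic
sum of `φ(…,a_i,…)(a_j)` etc. vanishes (with Koszul signs). -/
def DClosed (k : Type) [Field k] (A : AInftyAlg k) (φ : DFam k A A.V) : Prop :=
  ∀ (n : ℕ) (z : ℕ → A.V.El) (i j K : ℕ), i < j → j < K → K < n →
    sg k ((∑ t ∈ Finset.range (i + 1), (z t).1) * (∑ t ∈ Finset.Icc (i + 1) K, (z t).1)) *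
        cycEval k A φ n z i j
    + sg k ((∑ t ∈ Finset.range (j + 1), (z t).1) * (∑ t ∈ Finset.Icc (j + 1) K, (z t).1)) *
        cycEval k A φ n z j K
    + sg k 0 * cycEval k A φ n z K i = 0

/-- Homological nondegeneracy of `φ : A → A*`: every nonzero `m₁`-homology class
pairs nontrivially under `φ_{0,0}` with some class. -/
def DHomNondeg (k : Type) [Field k] (A : AInftyAlg k) (φ : DFam k A A.V) : Prop :=
  ∀ a : A.V.El, IsCycleAt A.V A.d a → ¬ IsBdryAt A.V A.d a →
    ∃ b : A.V.El, IsCycleAt A.V A.d b ∧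
      φ 0 0 (fun _ => A.V.zeroEl) a (fun _ => A.V.zeroEl) b ≠ 0

/-- Homological nondegeneracy of `φ : C → C*` for a bimodule `Cb`, with respect
to the differential `b_{0,0}`. -/
def DHomNondegBimod (k : Type) [Field k] {A : AInftyAlg k} (Cb : AInftyBimod k A)
    (φ : DFam k A Cb.M) : Prop :=
  ∀ a : Cb.M.El, IsCycleAt Cb.M Cb.d a → ¬ IsBdryAt Cb.M Cb.d a →
    ∃ b : Cb.M.El, IsCycleAt Cb.M Cb.d b ∧
      φ 0 0 (fun _ => A.V.zeroEl) a (fun _ => A.V.zeroEl) b ≠ 0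

/-- Chain-level nondegeneracy of `φ_{0,0}`. -/
def DChainNondeg (k : Type) [Field k] (A : AInftyAlg k) (M : GradedSpace k)
    (φ : DFam k A M) : Prop :=
  (∀ v : M.El, v.2 ≠ 0 → ∃ w, φ 0 0 (fun _ => A.V.zeroEl) v (fun _ => A.V.zeroEl) w ≠ 0) ∧
  (∀ w : M.El, w.2 ≠ 0 → ∃ v, φ 0 0 (fun _ => A.V.zeroEl) v (fun _ => A.V.zeroEl) w ≠ 0)

/-! ### Homotopy inner products -/

/-- A homotopy inner product on an A∞-bimodule `Cb` over `A`: an A∞-bimodule map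
`φ : C → C*` which factors as `g* ∘ ψ ∘ ĝ` through a bimodule `Db` with a cyclic
symmetric inner product `ψ`, along a bimodule quasi-isomorphism `g : C → D`. -/
def IsHomotopyIP (k : Type) [Field k] (A : AInftyAlg k) (Cb : AInftyBimod k A)
    (φ : DFam k A Cb.M) : Prop :=
  DFamGood k A Cb.M φ ∧ DualMapRel k A Cb.M Cb.b φ ∧
  ∃ (Db : AInftyBimod k A) (ψ : BimodCyclicIP k Db) (g : BimodQuasiIso k A Cb Db),
    ∀ kk l (x : ℕ → A.V.El) (v : Cb.M.El) (y : ℕ → A.V.El) (w : Cb.M.El),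
      φ kk l x v y w =
        ∑ i ∈ Finset.range (kk + 1), ∑ j ∈ Finset.range (l + 1),
          sg k (dsum x i * (dsum (shiftSeq x i) (kk - i) + v.1 + dsum y l + w.1)) *
            ψ.ip (g.g (kk - i) j (shiftSeq x i) v y)
                 (g.g (l - j) i (shiftSeq y j) w x)

/-- A strong homotopy inner product on an A∞-algebra `A`: an A∞-bimodule map
`φ : A → A*` which factors as `g* ∘ ψ ∘ ĝ` through a cyclic A∞-algebra `B`
along an A∞-quasi-isomorphism `f : A → B` (where `g = f̃`, `g_{k,l} = f_{k+l+1}`). -/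
def IsSHIP (k : Type) [Field k] (A : AInftyAlg k) (φ : DFam k A A.V) : Prop :=
  DFamGood k A A.V φ ∧ DualMapRel k A A.V (selfB k A) φ ∧
  ∃ (B : AInftyAlg k) (c : CyclicIP k B) (f : AInftyQuasiIso k A B),
    ∀ kk l (x : ℕ → A.V.El) (v : A.V.El) (y : ℕ → A.V.El) (w : A.V.El),
      φ kk l x v y w =
        ∑ i ∈ Finset.range (kk + 1), ∑ j ∈ Finset.range (l + 1),
          sg k (dsum x i * (dsum (shiftSeq x i) (kk - i) + v.1 + dsum y l + w.1)) *
            c.ip (f.f (kk - i + j + 1) (cat3 (shiftSeq x i) (kk - i) v y))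
                 (f.f (l - j + i + 1) (cat3 (shiftSeq y j) (l - j) w x))

end

section Words

variable {α β M N : Type}

section SplitSum

variable [AddCommMonoid M] [AddCommMonoid N]

/-- The sum of `χ u v` over all factorisations `w = u ++ v`. -/
def splitSum (χ : List α → List α → M) (w : List α) : M :=
  ∑ i ∈ Finset.range (w.length + 1), χ (w.take i) (w.drop i)

theorem splitSum_nil (χ : List α → List α → M) : splitSum χ [] = χ [] [] := by
  simp [splitSum]

theorem splitSum_cons (χ : List α → List α → M) (a : α) (w : List α) :
    splitSum χ (a :: w) = χ [] (a :: w) + splitSum (fun u v => χ (a :: u) v) w := by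
  simp only [splitSum, List.length_cons]
  rw [Finset.sum_range_succ', add_comm]
  simp

theorem splitSum_congr {χ χ' : List α → List α → M} {w : List α}
    (h : ∀ u v, u ++ v = w → χ u v = χ' u v) : splitSum χ w = splitSum χ' w :=
  Finset.sum_congr rfl fun _ _ => h _ _ (List.take_append_drop _ _)

theorem splitSum_add (χ χ' : List α → List α → M) (w : List α) :
    splitSum (fun u v => χ u v + χ' u v) w = splitSum χ w + splitSum χ' w :=
  Finset.sum_add_distrib

theorem splitSum_zero (w : List α) : splitSum (fun _ _ => (0 : M)) w = 0 :=
  Finset.sum_const_zero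

theorem map_splitSum {F : Type} [FunLike F M N] [AddMonoidHomClass F M N] (L : F)
    (χ : List α → List α → M) (w : List α) :
    L (splitSum χ w) = splitSum (fun u v => L (χ u v)) w :=
  map_sum L _ _

theorem smul_splitSum {k : Type} [Semiring k] [Module k M] (c : k)
    (χ : List α → List α → M) (w : List α) :
    c • splitSum χ w = splitSum (fun u v => c • χ u v) w :=
  Finset.smul_sum

/-- Coassociativity of deconcatenation. -/
theorem splitSum_splitSum (ψ : List α → List α → List α → M) (w : List α) :
    splitSum (fun u v => splitSum (ψ u) v) w =
      splitSum (fun u v => splitSum (fun u₁ u₂ => ψ u₁ u₂ v) u) w := by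
  induction w generalizing ψ with
  | nil => simp [splitSum_nil]
  | cons a w ih =>
    rw [splitSum_cons, splitSum_cons (fun u v => splitSum (fun u₁ u₂ => ψ u₁ u₂ v) u), ih,
      splitSum_cons]
    simp only [splitSum_nil, splitSum_cons, splitSum_add]
    abel

theorem splitSum_linear {k : Type} [Semiring k] [Module k M] (χ : List α → List α → M)
    (c : k) (x y z : α) (p r : List α)
    (h₁ : ∀ p₁ p₂, p₁ ++ p₂ = p →
      χ p₁ (p₂ ++ z :: r) = c • χ p₁ (p₂ ++ x :: r) + χ p₁ (p₂ ++ y :: r))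
    (h₂ : ∀ r₁ r₂, r₁ ++ r₂ = r →
      χ (p ++ z :: r₁) r₂ = c • χ (p ++ x :: r₁) r₂ + χ (p ++ y :: r₁) r₂) :
    splitSum χ (p ++ z :: r) = c • splitSum χ (p ++ x :: r) + splitSum χ (p ++ y :: r) := by
  induction p generalizing χ with
  | nil =>
    have h := h₁ [] [] rfl
    simp only [List.nil_append] at h h₂ ⊢
    rw [splitSum_cons, splitSum_cons, splitSum_cons, h,
      splitSum_congr (fun u v huv => h₂ u v huv), splitSum_add, ← smul_splitSum, smul_add]
    abel
  | cons a p ih =>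
    have h := h₁ [] (a :: p) rfl
    simp only [List.cons_append] at h ⊢
    rw [splitSum_cons, splitSum_cons, splitSum_cons, h,
      ih (fun u v => χ (a :: u) v) (fun p₁ p₂ hp => h₁ (a :: p₁) p₂ (by simp [hp])) h₂, smul_add]
    abel

end SplitSum

section BlockSum

variable [AddCommMonoid M]

/-- The sum of `φ [f u₁, …, f uᵣ]` over all factorisations `w = u₁ ++ ⋯ ++ uᵣ` into nonempty
words: the pullback of `φ` along the coalgebra map with Taylor coefficients `f`. -/
def blockSum (f : List α → β) (φ : List β → M) : List α → M
  | [] => φ []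
  | a :: w => ∑ i : Fin (w.length + 1),
      blockSum f (fun t => φ (f (a :: w.take i) :: t)) (w.drop i)
termination_by w => w.length

theorem blockSum_nil (f : List α → β) (φ : List β → M) : blockSum f φ [] = φ [] := by
  rw [blockSum]

theorem blockSum_cons (f : List α → β) (φ : List β → M) (a : α) (w : List α) :
    blockSum f φ (a :: w) =
      splitSum (fun u v => blockSum f (fun t => φ (f (a :: u) :: t)) v) w := by
  rw [blockSum, splitSum, ← Fin.sum_univ_eq_sum_range
    (fun i => blockSum f (fun t => φ (f (a :: w.take i) :: t)) (w.drop i))]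

/-- Induction on words in which the induction hypothesis holds for all tails of the word. -/
theorem List.tail_induction {P : List α → Prop} (nil : P [])
    (cons : ∀ a w, (∀ u v, u ++ v = w → P v) → P (a :: w)) (w : List α) : P w := by
  suffices h : ∀ n (w : List α), w.length ≤ n → P w from h _ w le_rfl
  intro n
  induction n with
  | zero => intro w hw; rw [List.length_eq_zero_iff.1 (Nat.le_zero.1 hw)]; exact nil
  | succ n ih =>
    rintro (_ | ⟨a, w⟩) hw
    · exact nil
    · refine cons a w fun u v huv => ih v ?_
      have := congrArg List.length huv
      simp at this hw
      omega

theorem blockSum_add (f : List α → β) (φ φ' : List β → M) (w : List α) :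
    blockSum f (fun t => φ t + φ' t) w = blockSum f φ w + blockSum f φ' w := by
  induction w using List.tail_induction generalizing φ φ' with
  | nil => simp [blockSum_nil]
  | cons a w ih =>
    simp only [blockSum_cons, ← splitSum_add]
    exact splitSum_congr fun u v h => ih u v h _ _

theorem map_blockSum {N F : Type} [AddCommMonoid N] [FunLike F M N] [AddMonoidHomClass F M N]
    (L : F) (f : List α → β) (φ : List β → M) (w : List α) :
    L (blockSum f φ w) = blockSum f (fun t => L (φ t)) w := by
  induction w using List.tail_induction generalizing φ with
  | nil => simp [blockSum_nil]
  | cons a w ih =>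
    simp only [blockSum_cons, map_splitSum]
    exact splitSum_congr fun u v h => ih u v h _

theorem smul_blockSum {k : Type} [Semiring k] [Module k M] (c : k) (f : List α → β)
    (φ : List β → M) (w : List α) :
    c • blockSum f φ w = blockSum f (fun t => c • φ t) w :=
  map_blockSum (DistribSMul.toAddMonoidHom M c) f φ w

/-- The pullback along a coalgebra map is compatible with deconcatenation. -/
theorem blockSum_splitSum (f : List α → β) (ψ : List β → List β → M) (w : List α) :
    blockSum f (splitSum ψ) w =
      splitSum (fun u v => blockSum f (fun s => blockSum f (fun t => ψ s t) v) u) w := by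
  induction w using List.tail_induction generalizing ψ with
  | nil => simp [blockSum_nil, splitSum_nil]
  | cons a w ih =>
    rw [blockSum_cons, splitSum_cons, blockSum_nil, blockSum_cons]
    simp only [splitSum_cons, blockSum_add, splitSum_add, blockSum_cons]
    congr 1
    rw [← splitSum_splitSum]
    exact splitSum_congr fun u v h => ih u v h _

end BlockSum

section CoderSum

variable {k : Type} [Field k] [AddCommGroup M] [Module k M]

/-- The sum of `± φ (u ++ q v :: t)` over all factorisations `w = u ++ v ++ t` with `v` nonempty,
the sign being the product of the `s a` for `a` in `u`: the pullback of `φ` along the coderivation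
with Taylor coefficients `q`. -/
def coderSum (s : α → k) (q : List α → α) : (List α → M) → List α → M
  | _, [] => 0
  | φ, a :: w => splitSum (fun u v => φ (q (a :: u) :: v)) w +
      s a • coderSum s q (fun t => φ (a :: t)) w

theorem coderSum_add (s : α → k) (q : List α → α) (φ φ' : List α → M) (w : List α) :
    coderSum s q (fun t => φ t + φ' t) w = coderSum s q φ w + coderSum s q φ' w := by
  induction w generalizing φ φ' with
  | nil => simp [coderSum]
  | cons a w ih => simp only [coderSum, ih, splitSum_add, smul_add]; abel

theorem map_coderSum {N : Type} [AddCommGroup N] [Module k N] (L : M →ₗ[k] N) (s : α → k)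
    (q : List α → α) (φ : List α → M) (w : List α) :
    L (coderSum s q φ w) = coderSum s q (fun t => L (φ t)) w := by
  induction w generalizing φ with
  | nil => simp [coderSum]
  | cons a w ih => simp only [coderSum, map_add, map_smul, map_splitSum, ih]

theorem smul_coderSum (c : k) (s : α → k) (q : List α → α) (φ : List α → M) (w : List α) :
    c • coderSum s q φ w = coderSum s q (fun t => c • φ t) w :=
  map_coderSum (LinearMap.lsmul k M c) s q φ w

/-- The pullback along a coderivation is compatible with deconcatenation. -/
theorem coderSum_splitSum (s : α → k) (q : List α → α) (χ : List α → List α → M) (w : List α) :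
    coderSum s q (splitSum χ) w =
      splitSum (fun u v => coderSum s q (fun t => χ t v) u +
        (u.map s).prod • coderSum s q (χ u) v) w := by
  induction w generalizing χ with
  | nil => simp [coderSum, splitSum_nil]
  | cons a w ih =>
    simp only [coderSum, splitSum_cons, splitSum_add, coderSum_add, ih, List.map_cons,
      List.prod_cons, mul_smul, smul_add, smul_splitSum, splitSum_splitSum, List.map_nil,
      List.prod_nil, one_smul]
    abel

end CoderSum

end Words
section GradedWords

variable {k : Type} [Field k] {V W X : GradedSpace k} {M : Type} [AddCommGroup M] [Module k M]

theorem sg_add (m n : ℤ) : sg k (m + n) = sg k m * sg k n := by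
  unfold sg
  by_cases hm : Even m <;> by_cases hn : Even n <;> simp [hm, hn, Int.even_add]

theorem sg_one : sg k 1 = -1 := by simp [sg]

namespace GradedSpace

/-- The homogeneous element of degree `d` given by `a`. -/
def of (V : GradedSpace k) (d : ℤ) (a : V.comp d) : V.El := ⟨d, a⟩

/-- The degree of a homogeneous element. -/
def El.deg (x : V.El) : ℤ := x.1

theorem deg_of (d : ℤ) (a : V.comp d) : (V.of d a).deg = d := rfl

theorem toComp_mk (D : ℤ) (a : V.comp D) : V.toComp D (V.of D a) = a :=
  dif_pos rfl

theorem toComp_of_ne {D : ℤ} {x : V.El} (h : x.deg ≠ D) : V.toComp D x = 0 :=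
  dif_neg h

theorem mk_toComp {D : ℤ} {x : V.El} (h : x.deg = D) : V.of D (V.toComp D x) = x := by
  subst h
  exact congrArg (V.of x.deg) (dif_pos rfl)

theorem toComp_linear (D d : ℤ) (c : k) (a b : V.comp d) :
    V.toComp D (V.of d (c • a + b)) = c • V.toComp D (V.of d a) + V.toComp D (V.of d b) := by
  by_cases h : d = D
  · subst h
    simp only [toComp_mk]
  · have h0 : ∀ z : V.comp d, V.toComp D (V.of d z) = 0 := fun z => toComp_of_ne h
    rw [h0, h0, h0, smul_zero, add_zero]

theorem El.ext_toComp {D : ℤ} {x y : V.El} (hx : x.deg = D) (hy : y.deg = D)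
    (h : V.toComp D x = V.toComp D y) : x = y := by
  rw [← mk_toComp hx, ← mk_toComp hy, h]

/-- The total degree of a word of homogeneous elements. -/
def wordDeg (w : List V.El) : ℤ := (w.map El.deg).sum

theorem wordDeg_nil : wordDeg ([] : List V.El) = 0 := rfl

theorem wordDeg_cons (x : V.El) (w : List V.El) : wordDeg (x :: w) = x.deg + wordDeg w := by
  simp [wordDeg]

theorem wordDeg_append (u v : List V.El) : wordDeg (u ++ v) = wordDeg u + wordDeg v := by
  simp [wordDeg]

theorem prod_map_sg (w : List V.El) : (w.map fun x => sg k x.deg).prod = sg k (wordDeg w) := by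
  induction w with
  | nil => simp [wordDeg_nil, sg]
  | cons x w ih => simp [wordDeg_cons, sg_add, ih]

/-- Functions on words of homogeneous elements that are linear in every letter. -/
def IsWordLinear (φ : List V.El → M) : Prop :=
  ∀ (u v : List V.El) (d : ℤ) (c : k) (a b : V.comp d),
    φ (u ++ (V.of d (c • a + b)) :: v) = c • φ (u ++ (V.of d a) :: v) + φ (u ++ (V.of d b) :: v)

namespace IsWordLinear

variable {φ : List V.El → M}

theorem cons (h : IsWordLinear φ) (x : V.El) : IsWordLinear fun t => φ (x :: t) :=
  fun u => h (x :: u)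

/-- The dependence of a word-linear function on its first letter. -/
def head (h : IsWordLinear φ) (d : ℤ) (v : List V.El) : V.comp d →ₗ[k] M where
  toFun z := φ ((V.of d z) :: v)
  map_add' a b := by simpa using h [] v d 1 a b
  map_smul' c a := by
    have h0 : φ ((V.of d 0) :: v) = 0 := by simpa using h [] v d 1 0 0
    simpa [h0] using h [] v d c a 0

theorem head_apply (h : IsWordLinear φ) (d : ℤ) (v : List V.El) (z : V.comp d) :
    h.head d v z = φ ((V.of d z) :: v) := rfl

theorem head_toComp (h : IsWordLinear φ) {d : ℤ} (v : List V.El) {x : V.El} (hx : x.deg = d) :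
    h.head d v (V.toComp d x) = φ (x :: v) := by
  rw [head_apply, mk_toComp hx]

theorem zero_cons (h : IsWordLinear φ) (d : ℤ) (v : List V.El) : φ ((V.of d 0) :: v) = 0 :=
  (h.head d v).map_zero

end IsWordLinear

/-- Families of multilinear operations of degree `e`, as functions on words, with vanishing
nullary operation. -/
structure IsMultiOp (e : ℤ) (q : List V.El → W.El) : Prop where
  nil : q [] = W.of e 0
  deg : ∀ w, (q w).deg = e + wordDeg w
  linear : ∀ D, IsWordLinear fun w => W.toComp D (q w)

theorem IsMultiOp.comp_linear {e : ℤ} {q : List V.El → W.El} (hq : IsMultiOp e q)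
    {φ : List W.El → M} (hφ : IsWordLinear φ) (u v : List V.El) (r : List W.El) (d : ℤ) (c : k)
    (a b : V.comp d) :
    φ (q (u ++ (V.of d (c • a + b)) :: v) :: r) =
      c • φ (q (u ++ (V.of d a) :: v) :: r) + φ (q (u ++ (V.of d b) :: v) :: r) := by
  have hdeg : ∀ z : V.comp d, (q (u ++ (V.of d z) :: v)).deg = e + (wordDeg u + (d + wordDeg v)) := by
    intro z
    rw [hq.deg, wordDeg_append, wordDeg_cons, deg_of]
  have hlin := hq.linear (e + (wordDeg u + (d + wordDeg v))) u v d c a b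
  simp only at hlin
  rw [← hφ.head_toComp r (hdeg _), ← hφ.head_toComp r (hdeg a), ← hφ.head_toComp r (hdeg b),
    hlin, map_add, map_smul]

theorem blockSum_congr {N : Type} [AddCommGroup N] {f : List V.El → W.El}
    (hf : ∀ w, (f w).deg = wordDeg w) {φ φ' : List W.El → N} {w : List V.El}
    (h : ∀ t, t.length ≤ w.length → wordDeg t = wordDeg w → φ t = φ' t) :
    blockSum f φ w = blockSum f φ' w := by
  induction w using List.tail_induction generalizing φ φ' with
  | nil => simpa [blockSum_nil] using h [] le_rfl rfl
  | cons a w ih =>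
    simp only [blockSum_cons]
    refine splitSum_congr fun u v huv => ih u v huv fun t ht htd => h _ ?_ ?_
    · have := congrArg List.length huv
      simp at this ⊢
      omega
    · rw [wordDeg_cons, hf, htd, ← huv, wordDeg_cons, wordDeg_cons, wordDeg_append, add_assoc]

/-- The leading term of the pullback along a coalgebra map. -/
theorem blockSum_eq_map {N : Type} [AddCommGroup N] {f : List V.El → W.El}
    (hf : ∀ w, (f w).deg = wordDeg w) {φ : List W.El → N} {w : List V.El}
    (h : ∀ t, t.length < w.length → wordDeg t = wordDeg w → φ t = 0) :
    blockSum f φ w = φ (w.map fun x => f [x]) := by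
  induction w generalizing φ with
  | nil => simp [blockSum_nil]
  | cons a w ih =>
    have h0 : ∀ u v, u ++ v = w → u ≠ [] →
        blockSum f (fun t => φ (f (a :: u) :: t)) v = 0 := by
      intro u v huv hu
      have hz : blockSum f (fun _ => (0 : N)) v = 0 := by
        simpa using (map_blockSum (0 : N →+ N) f (fun _ => (0 : N)) v).symm
      rw [← hz]
      refine blockSum_congr hf fun t ht htd => h _ ?_ ?_
      · have := congrArg List.length huv
        have := List.length_pos_iff.2 hu
        simp at *
        omega
      · rw [wordDeg_cons, hf, htd, ← huv, wordDeg_cons, wordDeg_cons, wordDeg_append, add_assoc]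
    have hmain : splitSum (fun u v => blockSum f (fun t => φ (f (a :: u) :: t)) v) w =
        blockSum f (fun t => φ (f [a] :: t)) w := by
      cases w with
      | nil => rw [splitSum_nil]
      | cons b w =>
        rw [splitSum_cons, splitSum_congr (χ' := fun _ _ => 0), splitSum_zero, add_zero]
        intro u v huv
        exact h0 (b :: u) v (by simp [huv]) (by simp)
    rw [blockSum_cons, hmain, ih]
    · simp
    · intro t ht htd
      refine h _ (by simpa using ht) ?_
      rw [wordDeg_cons, wordDeg_cons, hf, htd, wordDeg_cons, wordDeg_nil, add_zero]

theorem coderSum_congr {q : List V.El → V.El} {e : ℤ} (hq : ∀ w, (q w).deg = e + wordDeg w)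
    (s : V.El → k) {φ φ' : List V.El → M} {w : List V.El}
    (h : ∀ t, t ≠ [] → wordDeg t = e + wordDeg w → φ t = φ' t) :
    coderSum s q φ w = coderSum s q φ' w := by
  induction w generalizing φ φ' with
  | nil => rfl
  | cons a w ih =>
    simp only [coderSum]
    congr 1
    · refine splitSum_congr fun u v huv => h _ (by simp) ?_
      rw [wordDeg_cons, hq, ← huv, wordDeg_cons, wordDeg_cons, wordDeg_append]
      ring
    · congr 1
      refine ih fun t _ htd => h _ (by simp) ?_
      rw [wordDeg_cons, htd, wordDeg_cons]
      ring

theorem IsWordLinear.coderSum {q : List V.El → V.El} {e : ℤ} (hq : IsMultiOp e q)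
    {φ : List V.El → M} (hφ : IsWordLinear φ) :
    IsWordLinear (coderSum (fun x => sg k x.deg) q φ) := by
  intro u v d c a b
  induction u generalizing φ with
  | nil =>
    have h₁ : ∀ z : V.comp d, _root_.coderSum (fun x => sg k x.deg) q φ ((V.of d z) :: v) =
        splitSum (fun u v => φ (q ((V.of d z) :: u) :: v)) v +
          sg k d • _root_.coderSum (fun x => sg k x.deg) q (fun t => φ ((V.of d z) :: t)) v :=
      fun z => rfl
    have h₂ : (fun t => φ ((V.of d (c • a + b)) :: t)) =
        fun t => c • φ ((V.of d a) :: t) + φ ((V.of d b) :: t) := funext fun t => hφ [] t d c a b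
    simp only [List.nil_append]
    have h₃ : splitSum (fun u w => φ (q (V.of d (c • a + b) :: u) :: w)) v =
        splitSum (fun u w => c • φ (q (V.of d a :: u) :: w) + φ (q (V.of d b :: u) :: w)) v :=
      splitSum_congr fun u w _ => hq.comp_linear hφ [] u w d c a b
    rw [h₁, h₁, h₁, h₂, coderSum_add, ← smul_coderSum, h₃, splitSum_add, ← smul_splitSum]
    simp only [smul_add, smul_comm c]
    abel
  | cons x u ih =>
    simp only [List.cons_append, _root_.coderSum]
    rw [ih (hφ.cons x), splitSum_linear _ c (V.of d a) (V.of d b) (V.of d (c • a + b)) u v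
      (fun p₁ p₂ _ => hφ (q (x :: p₁) :: p₂) v d c a b)
      (fun r₁ r₂ _ => hq.comp_linear hφ (x :: u) r₁ r₂ d c a b)]
    simp only [smul_add, smul_comm c]
    abel

theorem IsWordLinear.blockSum {f : List V.El → W.El} {e : ℤ} (hf : IsMultiOp e f)
    {φ : List W.El → M} (hφ : IsWordLinear φ) : IsWordLinear (blockSum f φ) := by
  suffices h : ∀ w : List V.El, ∀ (φ : List W.El → M), IsWordLinear φ →
      ∀ (u v : List V.El) (d : ℤ) (c : k) (a b : V.comp d), u.length + (v.length + 1) = w.length →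
      _root_.blockSum f φ (u ++ (V.of d (c • a + b)) :: v) =
        c • _root_.blockSum f φ (u ++ (V.of d a) :: v) + _root_.blockSum f φ (u ++ (V.of d b) :: v) from
    fun u v d c a b => h (u ++ (V.of d a) :: v) φ hφ u v d c a b (by simp)
  intro w
  induction w using List.tail_induction with
  | nil => intro φ _ u v d c a b h; simp at h
  | cons x w ih =>
    intro φ hφ u v d c a b hlen
    cases u with
    | nil =>
      have h₁ : ∀ (u : List V.El), (fun t => φ (f ((V.of d (c • a + b)) :: u) :: t)) =
          fun t => c • φ (f ((V.of d a) :: u) :: t) + φ (f ((V.of d b) :: u) :: t) :=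
        fun u => funext fun t => hf.comp_linear hφ [] u t d c a b
      simp only [List.nil_append, blockSum_cons, h₁, blockSum_add, splitSum_add, smul_splitSum,
        smul_blockSum]
    | cons y u =>
      simp only [List.cons_append, blockSum_cons]
      refine splitSum_linear _ c (V.of d a) (V.of d b) (V.of d (c • a + b)) u v (fun p₁ p₂ hp => ?_)
        (fun r₁ r₂ _ => ?_)
      · have := congrArg List.length hp
        simp at this hlen
        refine ih (w.take p₁.length) (w.drop p₁.length) (List.take_append_drop _ _) _
          (hφ.cons _) p₂ v d c a b ?_
        simp
        omega
      · simp only [smul_blockSum, ← blockSum_add]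
        exact congrArg (fun g => _root_.blockSum f g r₂)
          (funext fun t => hf.comp_linear hφ (y :: u) r₁ t d c a b)

theorem coderSum_zero (s : V.El → k) (q : List V.El → V.El) (w : List V.El) :
    coderSum s q (fun _ => (0 : M)) w = 0 := by
  simpa using (map_coderSum (0 : M →ₗ[k] M) s q (fun _ => (0 : M)) w).symm

theorem blockSum_zero (f : List V.El → W.El) (w : List V.El) :
    blockSum f (fun _ => (0 : M)) w = 0 := by
  simpa using (map_blockSum (0 : M →ₗ[k] M) f (fun _ => (0 : M)) w).symm

/-- The terms of the pullback along a coderivation that do not involve the first letter. -/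
def coderTail (s : V.El → k) (q : List V.El → V.El) (φ : List V.El → M) : List V.El → M
  | [] => 0
  | a :: w => s a • coderSum s q (fun t => φ (a :: t)) w

theorem IsMultiOp.nil_cons {e : ℤ} {q : List V.El → W.El} (hq : IsMultiOp e q)
    {φ : List W.El → M} (hφ : IsWordLinear φ) (r : List W.El) : φ (q [] :: r) = 0 := by
  rw [hq.nil, hφ.zero_cons]

theorem coderSum_eq_add_coderTail (s : V.El → k) {e : ℤ} {q : List V.El → V.El}
    (hq : IsMultiOp e q) {φ : List V.El → M} (hφ : IsWordLinear φ) :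
    coderSum s q φ = fun w => splitSum (fun u v => φ (q u :: v)) w + coderTail s q φ w := by
  funext w
  cases w with
  | nil => simp [splitSum_nil, coderSum, coderTail, hq.nil_cons hφ]
  | cons a w => rw [splitSum_cons, hq.nil_cons hφ, zero_add, coderSum, coderTail]

theorem blockSum_eq_splitSum {e : ℤ} {f : List V.El → W.El} (hf : IsMultiOp e f)
    {φ : List W.El → M} (hφ : IsWordLinear φ) {w : List V.El} (hw : w ≠ []) :
    blockSum f φ w = splitSum (fun u v => blockSum f (fun t => φ (f u :: t)) v) w := by
  cases w with
  | nil => exact absurd rfl hw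
  | cons a w =>
    rw [splitSum_cons, blockSum_cons]
    rw [funext fun t => hf.nil_cons hφ t, blockSum_zero (k := k), zero_add]

theorem IsMultiOp.deg_eq {f : List V.El → W.El} (hf : IsMultiOp 0 f) (w : List V.El) :
    (f w).deg = wordDeg w := by rw [hf.deg, zero_add]

/-- The linear dependence of an iterated pullback on its first letter. -/
def IsWordLinear.blockHead {φ : List W.El → M} (hφ : IsWordLinear φ) (f : List V.El → W.El)
    (D : ℤ) (v : List V.El) : W.comp D →ₗ[k] M where
  toFun z := _root_.blockSum f (fun t => φ (W.of D z :: t)) v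
  map_add' a b := by
    rw [← blockSum_add]
    exact congrArg (fun g => _root_.blockSum f g v) (funext fun t => (hφ.head D t).map_add a b)
  map_smul' c a := by
    rw [RingHom.id_apply, smul_blockSum]
    exact congrArg (fun g => _root_.blockSum f g v) (funext fun t => (hφ.head D t).map_smul c a)

theorem IsWordLinear.blockHead_toComp {φ : List W.El → M} (hφ : IsWordLinear φ)
    (f : List V.El → W.El) {D : ℤ} (v : List V.El) {x : W.El} (hx : x.deg = D) :
    hφ.blockHead f D v (W.toComp D x) = _root_.blockSum f (fun t => φ (x :: t)) v := by
  rw [← mk_toComp hx, toComp_mk]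
  rfl

/-- A coalgebra map intertwining two coderivations up to its corestriction intertwines them. -/
theorem coderSum_blockSum {f : List V.El → W.El} {q : List V.El → V.El} {q' : List W.El → W.El}
    (hf : IsMultiOp 0 f) (hq : IsMultiOp 1 q) (hq' : IsMultiOp 1 q')
    (h : ∀ u, coderSum (fun x => sg k x.deg) q (fun t => W.toComp (1 + wordDeg u) (f t)) u =
      blockSum f (fun t => W.toComp (1 + wordDeg u) (q' t)) u)
    {φ : List W.El → M} (hφ : IsWordLinear φ) (w : List V.El) :
    coderSum (fun x => sg k x.deg) q (blockSum f φ) w =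
      blockSum f (coderSum (fun x => sg k x.deg) q' φ) w := by
  induction w using List.tail_induction generalizing φ with
  | nil => simp [blockSum_nil, coderSum]
  | cons a w ih =>
    have h₁ : ∀ u v, coderSum (fun x => sg k x.deg) q
        (fun t => blockSum f (fun t' => φ (f t :: t')) v) u =
        blockSum f (fun t => blockSum f (fun t' => φ (q' t :: t')) v) u := by
      intro u v
      rw [coderSum_congr (φ' := fun t => hφ.blockHead f (1 + wordDeg u) v
          (W.toComp (1 + wordDeg u) (f t))) hq.deg, ← map_coderSum, h, map_blockSum]
      · refine blockSum_congr hf.deg_eq fun t _ ht => hφ.blockHead_toComp f v ?_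
        rw [hq'.deg, ht]
      · intro t _ ht
        exact (hφ.blockHead_toComp f v (by rw [hf.deg_eq, ht])).symm
    have h₂ : splitSum (fun u v => sg k (wordDeg u) •
        coderSum (fun x => sg k x.deg) q (blockSum f (fun t => φ (f u :: t))) v) (a :: w) =
        blockSum f (coderTail (fun x => sg k x.deg) q' φ) (a :: w) := by
      rw [splitSum_cons, blockSum_cons, funext fun t => hf.nil_cons hφ t,
        show (blockSum f fun _ => (0 : M)) = fun _ => 0 from funext (blockSum_zero (k := k) f),
        coderSum_zero, smul_zero, zero_add]
      refine splitSum_congr fun u v huv => ?_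
      rw [ih u v huv (hφ.cons _), smul_blockSum]
      simp only [coderTail, hf.deg_eq]
    rw [coderSum_congr (φ' := splitSum fun u v => blockSum f (fun t => φ (f u :: t)) v) hq.deg
      _ fun t ht _ => blockSum_eq_splitSum hf hφ ht, coderSum_splitSum, splitSum_add,
      coderSum_eq_add_coderTail _ hq' hφ, blockSum_add, blockSum_splitSum]
    simp only [prod_map_sg, h₁]
    exact congrArg _ h₂

/-- A coderivation of odd degree whose square has vanishing corestriction squares to zero. -/
theorem coderSum_coderSum {q : List V.El → V.El} (hq : IsMultiOp 1 q)
    (h : ∀ u, coderSum (fun x => sg k x.deg) q (fun t => V.toComp (2 + wordDeg u) (q t)) u = 0)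
    {φ : List V.El → M} (hφ : IsWordLinear φ) (w : List V.El) :
    coderSum (fun x => sg k x.deg) q (coderSum (fun x => sg k x.deg) q φ) w = 0 := by
  induction w generalizing φ with
  | nil => rfl
  | cons a w ih =>
    have h₁ : ∀ u v, coderSum (fun x => sg k x.deg) q (fun t => φ (q t :: v)) u = 0 := by
      intro u v
      rw [coderSum_congr (φ' := fun t => hφ.head (2 + wordDeg u) v
        (V.toComp (2 + wordDeg u) (q t))) hq.deg, ← map_coderSum, h, map_zero]
      intro t _ ht
      exact (hφ.head_toComp v (by rw [hq.deg, ht]; ring)).symm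
    have h₂ : coderSum (fun x => sg k x.deg) q (coderTail (fun x => sg k x.deg) q φ) (a :: w) =
        splitSum (fun u v => - (sg k (wordDeg (a :: u)) •
          coderSum (fun x => sg k x.deg) q (fun t => φ (q (a :: u) :: t)) v)) w := by
      have h₃ : (fun t => coderTail (fun x => sg k x.deg) q φ (a :: t)) = fun t =>
        sg k a.deg • coderSum (fun x => sg k x.deg) q (fun t => φ (a :: t)) t := rfl
      rw [coderSum, h₃, ← smul_coderSum, ih (hφ.cons a), smul_zero, smul_zero, add_zero]
      refine splitSum_congr fun u v _ => ?_
      simp only [coderTail, hq.deg, sg_add, sg_one, neg_one_mul, neg_smul]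
    rw [coderSum_eq_add_coderTail _ hq hφ, coderSum_add, coderSum_splitSum,
      splitSum_add, h₂]
    simp only [prod_map_sg, h₁, splitSum_zero, zero_add]
    rw [splitSum_cons, funext fun t => hq.nil_cons hφ t, coderSum_zero, smul_zero, zero_add,
      ← splitSum_add]
    simp only [add_neg_cancel, splitSum_zero]

section Transport

variable (f : List V.El → W.El) (q : List V.El → V.El) (g : W.El → V.El)

/-- The component of degree `D` of the transported operations, by recursion on the length. -/
def transportComp (D : ℤ) (y : List W.El) : W.comp D :=
  coderSum (fun x => sg k x.deg) q (fun t => W.toComp D (f t)) (y.map g) -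
    blockSum f (fun t => if t.length < y.length then transportComp D t else 0) (y.map g)
termination_by y.length

/-- The operations transported from `q` along `f`. -/
def transportOp (y : List W.El) : W.El :=
  if y = [] then W.of 1 0 else W.of (1 + wordDeg y) (transportComp f q g (1 + wordDeg y) y)

variable {f q g}

theorem blockSum_transportComp (hf : IsMultiOp 0 f) (hgf : ∀ x, g (f [x]) = x) (D : ℤ)
    (w : List V.El) :
    blockSum f (transportComp f q g D) w =
      coderSum (fun x => sg k x.deg) q (fun t => W.toComp D (f t)) w := by
  have hlead := blockSum_eq_map (w := w) hf.deg_eq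
    (φ := fun t => if t.length < w.length then 0 else transportComp f q g D t)
    fun t ht _ => if_pos ht
  have hsplit := blockSum_add f (fun t => if t.length < w.length then transportComp f q g D t else 0)
    (fun t => if t.length < w.length then 0 else transportComp f q g D t) w
  have hsum : (fun t : List W.El =>
      (if t.length < w.length then transportComp f q g D t else 0) +
        (if t.length < w.length then 0 else transportComp f q g D t)) =
      transportComp f q g D := by
    funext t
    split_ifs <;> simp
  have hmap : (w.map fun x => f [x]).map g = w := by simp [Function.comp_def, hgf]
  rw [hsum, hlead, if_neg (by simp)] at hsplit
  rw [hsplit, transportComp, hmap, List.length_map, add_sub_cancel]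

theorem IsMultiOp.deg_section (hf : IsMultiOp 0 f) (hfg : ∀ y, f [g y] = y) (y : W.El) :
    (g y).deg = y.deg := by
  have := hf.deg_eq [g y]
  rw [hfg, wordDeg_cons, wordDeg_nil, add_zero] at this
  exact this.symm

theorem wordLinear_comp_map (hf : IsMultiOp 0 f) (hgf : ∀ x, g (f [x]) = x)
    (hfg : ∀ y, f [g y] = y) {φ : List V.El → M} (hφ : IsWordLinear φ) :
    IsWordLinear fun y : List W.El => φ (y.map g) := by
  have hdeg := hf.deg_section hfg
  intro u v d c a b
  obtain ⟨a', ha⟩ : ∃ a', g (W.of d a) = V.of d a' := ⟨_, (mk_toComp (hdeg _)).symm⟩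
  obtain ⟨b', hb⟩ : ∃ b', g (W.of d b) = V.of d b' := ⟨_, (mk_toComp (hdeg _)).symm⟩
  have hab : f [V.of d (c • a' + b')] = W.of d (c • a + b) := by
    refine El.ext_toComp (D := d) (by rw [hf.deg_eq, wordDeg_cons, wordDeg_nil, add_zero]; rfl)
      rfl ?_
    have := hf.linear d [] [] d c a' b'
    simp only [List.nil_append] at this
    rw [this, ← ha, ← hb, hfg, hfg, toComp_linear]
  simp only [List.map_append, List.map_cons, ← hab, hgf, ha, hb]
  exact hφ _ _ d c a' b'

theorem transportComp_linear (hf : IsMultiOp 0 f) (hq : IsMultiOp 1 q) (hgf : ∀ x, g (f [x]) = x)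
    (hfg : ∀ y, f [g y] = y) (D : ℤ) : IsWordLinear (transportComp f q g D) := by
  have htrunc : ∀ n : ℕ,
      IsWordLinear fun t => if t.length < n then transportComp f q g D t else 0 := by
    intro n
    induction n using Nat.strong_induction_on with
    | _ n ih =>
      intro u v d c a b
      by_cases hn : u.length + (v.length + 1) < n
      · have h₁ := wordLinear_comp_map hf hgf hfg ((hf.linear D).coderSum hq) u v d c a b
        have h₂ := wordLinear_comp_map hf hgf hfg ((ih _ hn).blockSum hf) u v d c a b
        have hval : ∀ z : W.comp d, transportComp f q g D (u ++ W.of d z :: v) =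
            coderSum (fun x => sg k x.deg) q (fun t => W.toComp D (f t))
              ((u ++ W.of d z :: v).map g) -
            blockSum f (fun t => if t.length < u.length + (v.length + 1)
              then transportComp f q g D t else 0) ((u ++ W.of d z :: v).map g) := by
          intro z
          rw [transportComp]
          simp only [List.length_append, List.length_cons]
        simp only [List.length_append, List.length_cons, if_pos hn] at h₁ h₂ ⊢
        rw [hval, hval a, hval b, h₁, h₂, smul_sub]
        abel
      · simp [hn]
  intro u v d c a b
  simpa using htrunc (u.length + (v.length + 1) + 1) u v d c a b

theorem toComp_transportOp (hf : IsMultiOp 0 f) (hgf : ∀ x, g (f [x]) = x) (y : List W.El) :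
    W.toComp (1 + wordDeg y) (transportOp f q g y) = transportComp f q g (1 + wordDeg y) y := by
  by_cases hy : y = []
  · subst hy
    have h0 := blockSum_transportComp (q := q) hf hgf 1 []
    rw [blockSum_nil, coderSum] at h0
    exact (dif_pos rfl : W.toComp 1 (W.of 1 0) = 0).trans h0.symm
  · rw [transportOp, if_neg hy, toComp_mk]

theorem isMultiOp_transportOp (hf : IsMultiOp 0 f) (hq : IsMultiOp 1 q)
    (hgf : ∀ x, g (f [x]) = x) (hfg : ∀ y, f [g y] = y) : IsMultiOp 1 (transportOp f q g) where
  nil := if_pos rfl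
  deg y := by
    unfold transportOp
    split_ifs with hy
    · subst hy; rfl
    · rfl
  linear D u v d c a b := by
    have hne : ∀ z : W.comp d, transportOp f q g (u ++ W.of d z :: v) =
        W.of (1 + wordDeg (u ++ W.of d z :: v))
          (transportComp f q g (1 + wordDeg (u ++ W.of d z :: v)) (u ++ W.of d z :: v)) :=
      fun z => if_neg (by simp)
    have hdeg : ∀ z : W.comp d, 1 + wordDeg (u ++ W.of d z :: v) =
        1 + (wordDeg u + (d + wordDeg v)) := by
      intro z
      rw [wordDeg_append, wordDeg_cons, deg_of]
    have hne' : ∀ z : W.comp d, transportOp f q g (u ++ W.of d z :: v) =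
        W.of (1 + (wordDeg u + (d + wordDeg v)))
          (transportComp f q g (1 + (wordDeg u + (d + wordDeg v))) (u ++ W.of d z :: v)) := by
      intro z
      rw [hne, hdeg]
    simp only [hne']
    rw [transportComp_linear hf hq hgf hfg, toComp_linear]

theorem coderSum_eq_blockSum_transportOp (hf : IsMultiOp 0 f) (hgf : ∀ x, g (f [x]) = x)
    (w : List V.El) :
    coderSum (fun x => sg k x.deg) q (fun t => W.toComp (1 + wordDeg w) (f t)) w =
      blockSum f (fun t => W.toComp (1 + wordDeg w) (transportOp f q g t)) w := by
  rw [← blockSum_transportComp hf hgf]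
  refine blockSum_congr hf.deg_eq fun t _ ht => ?_
  rw [← ht, toComp_transportOp hf hgf]

theorem coderSum_transportOp (hf : IsMultiOp 0 f) (hq : IsMultiOp 1 q)
    (hgf : ∀ x, g (f [x]) = x) (hfg : ∀ y, f [g y] = y)
    (h : ∀ u, coderSum (fun x => sg k x.deg) q (fun t => V.toComp (2 + wordDeg u) (q t)) u = 0)
    (y : List W.El) :
    coderSum (fun x => sg k x.deg) (transportOp f q g)
      (fun t => W.toComp (2 + wordDeg y) (transportOp f q g t)) y = 0 := by
  have hq' := isMultiOp_transportOp hf hq hgf hfg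
  have hcomm := coderSum_eq_blockSum_transportOp (q := q) hf hgf
  suffices hs : ∀ (D : ℤ) (n : ℕ) (y : List W.El), y.length = n → 2 + wordDeg y = D →
      coderSum (fun x => sg k x.deg) (transportOp f q g)
        (fun t => W.toComp D (transportOp f q g t)) y = 0 from hs _ _ y rfl rfl
  intro D n
  induction n using Nat.strong_induction_on with
  | _ n ih =>
    intro y hn hD
    have hmap : (y.map g).map (fun x => f [x]) = y := by simp [Function.comp_def, hfg]
    have hdeg : wordDeg (y.map g) = wordDeg y := by
      simp [wordDeg, Function.comp_def, hf.deg_section hfg]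
    have hlead := blockSum_eq_map (w := y.map g) hf.deg_eq
      (φ := coderSum (fun x => sg k x.deg) (transportOp f q g)
        (fun t => W.toComp D (transportOp f q g t)))
      fun t ht htd => ih t.length (by simpa [hn] using ht) t rfl (by rw [htd, hdeg, hD])
    rw [hmap] at hlead
    rw [← hlead, ← coderSum_blockSum hf hq hq' hcomm (hq'.linear D),
      coderSum_congr (φ' := coderSum (fun x => sg k x.deg) q (fun t => W.toComp D (f t))) hq.deg,
      coderSum_coderSum hq h (hf.linear D)]
    intro t _ ht
    obtain rfl : D = 1 + wordDeg t := by rw [ht, hdeg, ← hD]; ring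
    exact (hcomm t).symm

end Transport

end GradedSpace

end GradedWords
section SequenceWords

variable {α β M : Type} [AddCommGroup M]

/-- The word formed by the first `n` entries of a sequence. -/
def seqWord (x : ℕ → α) (n : ℕ) : List α := (List.range n).map x

theorem length_seqWord (x : ℕ → α) (n : ℕ) : (seqWord x n).length = n := by simp [seqWord]

theorem seqWord_zero (x : ℕ → α) : seqWord x 0 = [] := rfl

theorem seqWord_one (x : ℕ → α) : seqWord x 1 = [x 0] := rfl

theorem seqWord_congr {x y : ℕ → α} {n : ℕ} (h : ∀ i < n, x i = y i) :
    seqWord x n = seqWord y n :=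
  List.map_congr_left fun i hi => h i (List.mem_range.1 hi)

theorem seqWord_add (x : ℕ → α) (m n : ℕ) :
    seqWord x (m + n) = seqWord x m ++ seqWord (shiftSeq x m) n := by
  simp [seqWord, List.range_add, shiftSeq, Function.comp_def]

theorem seqWord_succ (x : ℕ → α) (n : ℕ) :
    seqWord x (n + 1) = x 0 :: seqWord (shiftSeq x 1) n := by
  rw [add_comm, seqWord_add, seqWord_one, List.singleton_append]

theorem shiftSeq_shiftSeq (x : ℕ → α) (m n : ℕ) :
    shiftSeq (shiftSeq x m) n = shiftSeq x (m + n) :=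
  funext fun j => congrArg x (add_assoc m n j).symm

theorem shiftSeq_zero (x : ℕ → α) : shiftSeq x 0 = x :=
  funext fun j => congrArg x (zero_add j)

theorem getD_seqWord (x : ℕ → α) {n i : ℕ} (h : i < n) (d : α) : (seqWord x n).getD i d = x i := by
  simp [seqWord, h]

theorem seqWord_getD (l : List α) (d : α) : seqWord (fun i => l.getD i d) l.length = l := by
  refine List.ext_getElem (length_seqWord _ _) fun i _ h => ?_
  simp [seqWord, h]

theorem seqWord_insertAt (x : ℕ → α) {i len n : ℕ} (hlen : 1 ≤ len) (h : i + len ≤ n) (v : α) :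
    seqWord (insertAt x i len v) (n - len + 1) =
      seqWord x i ++ v :: seqWord (shiftSeq x (i + len)) (n - i - len) := by
  have hn : n - len + 1 = i + ((n - i - len) + 1) := by omega
  have hv : shiftSeq (insertAt x i len v) i 0 = v := by simp [shiftSeq, insertAt]
  have hs : shiftSeq (shiftSeq (insertAt x i len v) i) 1 = shiftSeq x (i + len) := by
    funext j
    simp only [shiftSeq, insertAt]
    rw [if_neg (by omega), if_neg (by omega)]
    congr 1
    omega
  rw [hn, seqWord_add, seqWord_succ, hv, hs]
  congr 1
  exact seqWord_congr fun j hj => if_pos hj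

theorem seqWord_update (x : ℕ → α) {i n : ℕ} (h : i < n) (v : α) :
    seqWord (Function.update x i v) n =
      seqWord x i ++ v :: seqWord (shiftSeq x (i + 1)) (n - i - 1) := by
  rw [← seqWord_insertAt x le_rfl h, Nat.sub_add_cancel (by omega)]
  refine seqWord_congr fun j _ => ?_
  rcases lt_trichotomy j i with hj | rfl | hj
  · simp [insertAt, hj, hj.ne]
  · simp [insertAt]
  · simp [insertAt, hj.ne', hj.not_gt]

theorem splitSum_seqWord (χ : List α → List α → M) (x : ℕ → α) (n : ℕ) :
    splitSum χ (seqWord x n) =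
      ∑ i ∈ Finset.range (n + 1), χ (seqWord x i) (seqWord (shiftSeq x i) (n - i)) := by
  rw [splitSum, length_seqWord]
  refine Finset.sum_congr rfl fun i hi => ?_
  have hi' : i ≤ n := Nat.lt_succ_iff.1 (Finset.mem_range.1 hi)
  obtain ⟨m, rfl⟩ := Nat.exists_eq_add_of_le hi'
  rw [seqWord_add, Nat.add_sub_cancel_left, List.take_left' (length_seqWord x i),
    List.drop_left' (length_seqWord x i)]

theorem coderSum_seqWord {k : Type} [Field k] [Module k M] (s : α → k) (q : List α → α)
    (φ : List α → M) (x : ℕ → α) (n : ℕ) :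
    coderSum s q φ (seqWord x n) =
      ∑ i ∈ Finset.range n, ∑ len ∈ Finset.Icc 1 (n - i), ((seqWord x i).map s).prod •
        φ (seqWord x i ++ q (seqWord (shiftSeq x i) len) ::
          seqWord (shiftSeq x (i + len)) (n - i - len)) := by
  induction n generalizing x φ with
  | zero => simp [seqWord_zero, coderSum]
  | succ n ih =>
    rw [seqWord_succ, coderSum, ih, Finset.sum_range_succ', splitSum_seqWord, add_comm,
      Finset.smul_sum]
    congr 1
    · refine Finset.sum_congr rfl fun i _ => ?_
      rw [Finset.smul_sum, Nat.add_sub_add_right]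
      refine Finset.sum_congr rfl fun len _ => ?_
      rw [seqWord_succ, List.map_cons, List.prod_cons, mul_smul, shiftSeq_shiftSeq,
        shiftSeq_shiftSeq, List.cons_append, add_comm 1 i, add_comm 1 (i + len),
        add_right_comm i len 1]
    · rw [Nat.sub_zero, ← Finset.Ico_succ_right_eq_Icc, Finset.sum_Ico_eq_sum_range]
      refine Finset.sum_congr (by simp) fun j _ => ?_
      rw [add_comm 1 j, ← seqWord_succ, shiftSeq_zero, seqWord_zero, shiftSeq_shiftSeq,
        zero_add, add_comm 1 j, show n + 1 - (j + 1) = n - j by omega]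
      simp

/-- The word obtained by applying `f` to consecutive blocks of a sequence. -/
def blockWord (f : List α → β) : (ℕ → α) → List ℕ → List β
  | _, [] => []
  | x, b :: l => f (seqWord x b) :: blockWord f (shiftSeq x b) l

theorem seqWord_eq_blockWord (f : List α → β) (x : ℕ → α) (l : List ℕ) :
    seqWord (fun j => f (seqWord (shiftSeq x (l.take j).sum) (l.getD j 0))) l.length =
      blockWord f x l := by
  induction l generalizing x with
  | nil => rfl
  | cons b l ih =>
    rw [List.length_cons, seqWord_succ, blockWord, ← ih]
    congr 1
    · simp [shiftSeq_zero]
    · refine seqWord_congr fun j _ => ?_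
      simp only [shiftSeq_shiftSeq]
      simp [shiftSeq, add_comm 1 j]

theorem sum_composition_succ (n : ℕ) (F : List ℕ → M) :
    ∑ c : Composition (n + 1), F c.blocks =
      ∑ i ∈ Finset.range (n + 1), ∑ c : Composition (n - i), F ((i + 1) :: c.blocks) := by
  let e : (Σ i : Fin (n + 1), Composition (n - i)) → Composition (n + 1) := fun p =>
    { blocks := (p.1 + 1) :: p.2.blocks
      blocks_pos := by
        intro b hb
        rcases List.mem_cons.1 hb with rfl | hb
        · omega
        · exact p.2.blocks_pos hb
      blocks_sum := by
        have := p.1.2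
        rw [List.sum_cons, p.2.blocks_sum]
        omega }
  have he : Function.Bijective e := by
    constructor
    · rintro ⟨i, c⟩ ⟨j, c'⟩ h
      have hb : ((i : ℕ) + 1) :: c.blocks = ((j : ℕ) + 1) :: c'.blocks := congrArg Composition.blocks h
      obtain ⟨h₁, h₂⟩ := List.cons.inj hb
      obtain rfl : i = j := Fin.ext (Nat.succ.inj h₁)
      rw [Composition.ext h₂]
    · rintro ⟨blocks, hpos, hsum⟩
      cases blocks with
      | nil => simp at hsum
      | cons b l =>
        have hb : 0 < b := hpos (by simp)
        rw [List.sum_cons] at hsum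
        refine ⟨⟨⟨b - 1, by omega⟩, ⟨l, fun hi => hpos (by simp [hi]), ?_⟩⟩, ?_⟩
        · show l.sum = n - (b - 1)
          omega
        · refine Composition.ext ?_
          show (b - 1 + 1) :: l = b :: l
          rw [Nat.sub_add_cancel hb]
  rw [← he.sum_comp, Fintype.sum_sigma,
    ← Fin.sum_univ_eq_sum_range fun i => ∑ c : Composition (n - i), F ((i + 1) :: c.blocks)]

theorem sum_composition_blockWord (f : List α → β) (φ : List β → M) (x : ℕ → α) (n : ℕ) :
    ∑ c : Composition n, φ (blockWord f x c.blocks) = blockSum f φ (seqWord x n) := by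
  induction n using Nat.strong_induction_on generalizing x φ with
  | _ n ih =>
    cases n with
    | zero =>
      have hc : ∀ c : Composition 0, c.blocks = [] := fun c => by
        rw [← List.length_eq_zero_iff]
        exact Nat.le_zero.1 c.length_le
      rw [seqWord_zero, blockSum_nil, Fintype.sum_congr _ (fun _ => φ [])]
      · simp [composition_card]
      · intro c
        rw [hc, blockWord]
    | succ n =>
      rw [sum_composition_succ n fun l => φ (blockWord f x l), seqWord_succ, blockSum_cons,
        splitSum_seqWord]
      refine Finset.sum_congr rfl fun i _ => ?_
      rw [← ih (n - i) (by omega), shiftSeq_shiftSeq, ← seqWord_succ, add_comm 1 i]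
      rfl

end SequenceWords

section Bridge

variable {k : Type} [Field k] {V W : GradedSpace k}

namespace GradedSpace

theorem wordDeg_seqWord (x : ℕ → V.El) (n : ℕ) : wordDeg (seqWord x n) = dsum x n := by
  induction n with
  | zero => simp [seqWord_zero, wordDeg_nil, dsum]
  | succ n ih =>
    rw [seqWord_add, wordDeg_append, ih, dsum, dsum, Finset.sum_range_succ, seqWord_one,
      wordDeg_cons, wordDeg_nil, add_zero]
    rfl

/-- The family of operations on sequences `F`, as a function on words with vanishing nullary
part of degree `e`. -/
def wordOp (e : ℤ) (F : ℕ → (ℕ → V.El) → W.El) (w : List V.El) : W.El :=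
  if w = [] then W.of e 0 else F w.length fun i => w.getD i V.zeroEl

variable {e : ℤ} {F : ℕ → (ℕ → V.El) → W.El}

theorem wordOp_seqWord (hext : ∀ n (x y : ℕ → V.El), (∀ i < n, x i = y i) → F n x = F n y)
    (x : ℕ → V.El) {n : ℕ} (hn : 1 ≤ n) : wordOp e F (seqWord x n) = F n x := by
  have hne : seqWord x n ≠ [] := fun h => by
    have := congrArg List.length h
    rw [length_seqWord, List.length_nil] at this
    omega
  rw [wordOp, if_neg hne, length_seqWord]
  exact hext n _ _ fun i hi => getD_seqWord x hi _

theorem isMultiOp_wordOp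
    (hext : ∀ n (x y : ℕ → V.El), (∀ i < n, x i = y i) → F n x = F n y)
    (hdeg : ∀ n x, 1 ≤ n → (F n x).1 = e + dsum x n)
    (hadd : ∀ n (x : ℕ → V.El) i, i < n → ∀ (a b : V.comp (x i).1) (D : ℤ),
      W.toComp D (F n (Function.update x i ⟨(x i).1, a + b⟩)) =
        W.toComp D (F n (Function.update x i ⟨(x i).1, a⟩)) +
          W.toComp D (F n (Function.update x i ⟨(x i).1, b⟩)))
    (hsmul : ∀ n (x : ℕ → V.El) i, i < n → ∀ (c : k) (a : V.comp (x i).1) (D : ℤ),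
      W.toComp D (F n (Function.update x i ⟨(x i).1, c • a⟩)) =
        c • W.toComp D (F n (Function.update x i ⟨(x i).1, a⟩))) :
    IsMultiOp e (wordOp e F) where
  nil := if_pos rfl
  deg w := by
    cases w with
    | nil => exact (add_zero e).symm
    | cons a w =>
      conv_lhs => rw [← seqWord_getD (a :: w) V.zeroEl]
      rw [wordOp_seqWord hext _ (by simp)]
      refine (hdeg _ _ (by simp)).trans ?_
      rw [← wordDeg_seqWord, seqWord_getD]
  linear D u v d c a b := by
    have hlin : ∀ (n : ℕ) (x : ℕ → V.El) (i : ℕ), i < n → ∀ y : V.El, x i = y →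
        ∀ a b : V.comp y.1, W.toComp D (F n (Function.update x i (V.of y.1 (c • a + b)))) =
          c • W.toComp D (F n (Function.update x i (V.of y.1 a))) +
            W.toComp D (F n (Function.update x i (V.of y.1 b))) := by
      rintro n x i hi _ rfl a b
      exact (hadd n x i hi _ _ D).trans (congrArg (· + _) (hsmul n x i hi c a D))
    let x : ℕ → V.El := fun i => (u ++ V.of d 0 :: v).getD i V.zeroEl
    have hi : u.length < (u ++ V.of d 0 :: v).length := by simp
    have hself : seqWord (Function.update x u.length (x u.length)) (u ++ V.of d 0 :: v).length =
        u ++ V.of d 0 :: v := by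
      rw [Function.update_eq_self]
      exact seqWord_getD _ _
    rw [seqWord_update x hi] at hself
    obtain ⟨hu, hv⟩ := List.append_inj hself (length_seqWord _ _)
    obtain ⟨hx, hv⟩ := List.cons.inj hv
    have hword : ∀ z : V.comp d, u ++ V.of d z :: v =
        seqWord (Function.update x u.length (V.of d z)) (u ++ V.of d 0 :: v).length := by
      intro z
      rw [seqWord_update x hi, hu, hv]
    have hn : 1 ≤ (u ++ V.of d 0 :: v).length := Nat.one_le_of_lt hi
    beta_reduce
    rw [hword (c • a + b), hword a, hword b, wordOp_seqWord hext _ hn, wordOp_seqWord hext _ hn,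
      wordOp_seqWord hext _ hn]
    exact hlin _ x _ hi (V.of d 0) hx a b

theorem IsMultiOp.toComp_update {q : List V.El → W.El} (hq : IsMultiOp e q) {n : ℕ}
    (x : ℕ → V.El) {i : ℕ} (hi : i < n) (d D : ℤ) (c : k) (a b : V.comp d) :
    W.toComp D (q (seqWord (Function.update x i (V.of d (c • a + b))) n)) =
      c • W.toComp D (q (seqWord (Function.update x i (V.of d a)) n)) +
        W.toComp D (q (seqWord (Function.update x i (V.of d b)) n)) := by
  rw [seqWord_update x hi, seqWord_update x hi, seqWord_update x hi]
  exact hq.linear D _ _ d c a b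

theorem coderSum_seqWord_eq_sum_insertAt {M : Type} [AddCommGroup M] [Module k M]
    (q : List V.El → V.El) (φ : List V.El → M) (x : ℕ → V.El) (n : ℕ) :
    coderSum (fun x => sg k x.deg) q φ (seqWord x n) =
      ∑ i ∈ Finset.range n, ∑ len ∈ Finset.Icc 1 (n - i), sg k (dsum x i) •
        φ (seqWord (insertAt x i len (q (seqWord (shiftSeq x i) len))) (n - len + 1)) := by
  rw [coderSum_seqWord]
  refine Finset.sum_congr rfl fun i hi => Finset.sum_congr rfl fun len hlen => ?_
  have hi := Finset.mem_range.1 hi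
  have hlen := Finset.mem_Icc.1 hlen
  rw [seqWord_insertAt x hlen.1 (by omega), prod_map_sg, wordDeg_seqWord]

theorem algFamProps_of_isMultiOp {q : List V.El → V.El} (hq : IsMultiOp 1 q)
    (h : ∀ u, coderSum (fun x => sg k x.deg) q (fun t => V.toComp (2 + wordDeg u) (q t)) u = 0) :
    AlgFamProps k V fun n x => q (seqWord x n) := by
  refine ⟨fun n x y hxy => congrArg q (seqWord_congr hxy), fun x => hq.nil, fun n x => ?_,
    fun n x i hi a b D => ?_, fun n x i hi c a D => ?_, fun n x _ => ?_⟩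
  · exact (hq.deg _).trans (by rw [wordDeg_seqWord])
  · have := hq.toComp_update x hi (x i).1 D 1 a b
    rwa [one_smul, one_smul] at this
  · have h0 := hq.toComp_update x hi (x i).1 D 1 0 0
    rw [one_smul, one_smul, add_zero, left_eq_add] at h0
    have := hq.toComp_update x hi (x i).1 D c a 0
    rwa [h0, add_zero, add_zero] at this
  · have := h (seqWord x n)
    rwa [coderSum_seqWord_eq_sum_insertAt, wordDeg_seqWord] at this

theorem sum_composition_seqWord {M : Type} [AddCommGroup M]
    (hext : ∀ n (x y : ℕ → V.El), (∀ i < n, x i = y i) → F n x = F n y)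
    (φ : List W.El → M) (x : ℕ → V.El) (n : ℕ) :
    ∑ c : Composition n, φ (seqWord (fun j =>
        if h : j < c.length then F (c.blocksFun ⟨j, h⟩) (shiftSeq x (c.sizeUpTo j))
        else W.zeroEl) c.length) = blockSum (wordOp e F) φ (seqWord x n) := by
  rw [← sum_composition_blockWord]
  refine Finset.sum_congr rfl fun c _ => ?_
  rw [← seqWord_eq_blockWord]
  refine congrArg φ (seqWord_congr fun j hj => ?_)
  have hget : c.blocks.getD j 0 = c.blocksFun ⟨j, hj⟩ := by
    rw [List.getD_eq_getElem _ _ hj]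
    rfl
  rw [dif_pos hj, hget, wordOp_seqWord hext _ (c.one_le_blocksFun _)]
  rfl

end GradedSpace

end Bridge

open GradedSpace

/-- **Transport of A∞-algebra structures** (Cho, Lemma in the proof of Theorem
`thm:sh`): given an A∞-algebra `(A,m)`, a graded vector space `B`, and a family
of multilinear maps `f_k : A[1]^{⊗k} → B` such that `f₁` is a vector space
isomorphism, there exists an A∞-algebra structure `m^B` on `B` such that
`f = {f_k}` is an A∞-quasi-isomorphism from `A` to `(B, m^B)`. -/
theorem transport_algebra_structure
    (k : Type) [Field k] [CharZero k] (A : AInftyAlg k) (B : GradedSpace k)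
    (f : ℕ → (ℕ → A.V.El) → B.El)
    (hext : ∀ n (x y : ℕ → A.V.El), (∀ i < n, x i = y i) → f n x = f n y)
    (hdeg : ∀ n x, 1 ≤ n → (f n x).1 = dsum x n)
    (hadd : ∀ n (x : ℕ → A.V.El) i, i < n → ∀ (a b : A.V.comp (x i).1) (D : ℤ),
      B.toComp D (f n (Function.update x i ⟨(x i).1, a + b⟩)) =
        B.toComp D (f n (Function.update x i ⟨(x i).1, a⟩)) +
          B.toComp D (f n (Function.update x i ⟨(x i).1, b⟩)))
    (hsmul : ∀ n (x : ℕ → A.V.El) i, i < n → ∀ (c : k) (a : A.V.comp (x i).1) (D : ℤ),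
      B.toComp D (f n (Function.update x i ⟨(x i).1, c • a⟩)) =
        c • B.toComp D (f n (Function.update x i ⟨(x i).1, a⟩)))
    (hiso : Function.Bijective (fun x : A.V.El => f 1 (fun _ => x))) :
    ∃ mB : ℕ → (ℕ → B.El) → B.El,
      AlgFamProps k B mB ∧ HomFamProps k A B mB f ∧
      (∀ y : B.El, IsCycleAt B (fun z => mB 1 (fun _ => z)) y →
        ∃ x : A.V.El, x.1 = y.1 ∧ IsCycleAt A.V A.d x ∧
          IsBdryAt B (fun z => mB 1 (fun _ => z)) (B.subEl (f 1 (fun _ => x)) y)) ∧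
      (∀ x : A.V.El, IsCycleAt A.V A.d x →
        IsBdryAt B (fun z => mB 1 (fun _ => z)) (f 1 (fun _ => x)) →
        IsBdryAt A.V A.d x) := by
  have hf : IsMultiOp 0 (wordOp 0 f) :=
    isMultiOp_wordOp hext (fun n x hn => (hdeg n x hn).trans (zero_add _).symm) hadd hsmul
  obtain ⟨hmext, hm0, hmdeg, hmadd, hmsmul, hmrel⟩ := A.props
  have hq : IsMultiOp 1 (wordOp 1 A.m) :=
    isMultiOp_wordOp hmext (fun n x _ => hmdeg n x) hmadd hmsmul
  have hqm : ∀ n x, wordOp 1 A.m (seqWord x n) = A.m n x := by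
    intro n x
    cases n with
    | zero => exact hq.nil.trans (hm0 x).symm
    | succ n => exact wordOp_seqWord hmext x (Nat.succ_pos n)
  have hfw : ∀ n x, 1 ≤ n → wordOp 0 f (seqWord x n) = f n x :=
    fun n x hn => wordOp_seqWord hext x hn
  have hrel : ∀ u, coderSum (fun x => sg k x.deg) (wordOp 1 A.m)
      (fun t => A.V.toComp (2 + wordDeg u) (wordOp 1 A.m t)) u = 0 := by
    intro u
    cases u with
    | nil => rfl
    | cons a u =>
      have := hmrel (a :: u).length (fun i => (a :: u).getD i A.V.zeroEl) (Nat.succ_pos _)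
      simp only [← hqm] at this
      rwa [← wordDeg_seqWord, ← coderSum_seqWord_eq_sum_insertAt (wordOp 1 A.m)
        (fun t => A.V.toComp _ (wordOp 1 A.m t)), seqWord_getD] at this
  have hf1 : ∀ x : A.V.El, wordOp 0 f [x] = f 1 fun _ => x := fun x => hfw 1 (fun _ => x) le_rfl
  obtain ⟨g, hgf, hfg⟩ := Function.bijective_iff_has_inverse.1 hiso
  have hgf' : ∀ x, g (wordOp 0 f [x]) = x := fun x => (congrArg g (hf1 x)).trans (hgf x)
  have hfg' : ∀ y, wordOp 0 f [g y] = y := fun y => (hf1 _).trans (hfg y)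
  have hq' := isMultiOp_transportOp hf hq hgf' hfg'
  have hcomm := coderSum_eq_blockSum_transportOp (q := wordOp 1 A.m) hf hgf'
  have hm1 : ∀ x : A.V.El, transportOp (wordOp 0 f) (wordOp 1 A.m) g [wordOp 0 f [x]] =
      wordOp 0 f [A.d x] := by
    intro x
    have h := hcomm [x]
    have hx : wordOp 1 A.m [x] = A.d x := hqm 1 fun _ => x
    rw [blockSum_cons, splitSum_nil, blockSum_nil, coderSum, coderSum, splitSum_nil, smul_zero,
      add_zero, hx] at h
    refine El.ext_toComp ?_ ?_ h.symm
    · rw [hq'.deg, wordDeg_cons, hf.deg_eq, wordDeg_nil, add_zero]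
    · rw [hf.deg_eq, ← hx, wordDeg_cons, hq.deg, wordDeg_nil, add_zero]
  have hinj : ∀ x x', wordOp 0 f [x] = wordOp 0 f [x'] → x = x' := by
    intro x x' h
    rw [← hgf' x, h, hgf']
  have hzero : ∀ d, wordOp 0 f [A.V.of d 0] = B.of d 0 := by
    intro d
    have h := (hf.linear d).zero_cons d []
    rw [← mk_toComp (D := d) (x := wordOp 0 f [A.V.of d 0])]
    · exact congrArg (B.of d) h
    · rw [hf.deg_eq, wordDeg_cons, wordDeg_nil, add_zero, deg_of]
  have hself : ∀ y : B.El, B.toComp y.1 y = y.2 := fun y => dif_pos rfl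
  refine ⟨fun n y => transportOp (wordOp 0 f) (wordOp 1 A.m) g (seqWord y n),
    algFamProps_of_isMultiOp hq' (coderSum_transportOp hf hq hgf' hfg' hrel),
    ⟨hext, hdeg, hadd, hsmul, fun n x hn => ?_⟩, fun y hy => ⟨g y, hf.deg_section hfg' y, ?_, ?_⟩,
    fun x _ hx => ?_⟩
  · have h := hcomm (seqWord x n)
    rw [coderSum_seqWord_eq_sum_insertAt, wordDeg_seqWord,
      ← sum_composition_seqWord hext
        (fun t => B.toComp (1 + dsum x n) (transportOp (wordOp 0 f) (wordOp 1 A.m) g t))] at h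
    simp only [hqm] at h
    refine Eq.trans (Finset.sum_congr rfl fun i _ => Finset.sum_congr rfl fun len _ => ?_) h
    rw [hfw _ _ (Nat.le_add_left 1 _)]
  · refine hinj _ _ ?_
    rw [← hm1, hfg']
    exact (hy : transportOp _ _ g [y] = _).trans
      ((congrArg (fun e => B.of (e + 1) 0) (hf.deg_section hfg' y).symm).trans (hzero _).symm)
  · refine ⟨B.of (y.1 - 1) 0, ?_⟩
    have hy' : f 1 (fun _ => g y) = y := hfg y
    have h0 : B.subEl (f 1 fun _ => g y) y = B.of (1 + (y.1 - 1)) 0 := by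
      rw [hy', subEl, hself, sub_self, add_sub_cancel]
      rfl
    have hd := hq'.deg [B.of (y.1 - 1) 0]
    rw [wordDeg_cons, wordDeg_nil, add_zero, deg_of] at hd
    refine (mk_toComp hd).symm.trans (Eq.trans ?_ h0.symm)
    exact congrArg (B.of _) ((hq'.linear _).zero_cons _ [])
  · obtain ⟨z, hz⟩ := hx
    refine ⟨g z, hinj _ _ ?_⟩
    rw [← hm1, hfg', hf1]
    exact hz
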